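/- arXiv:1202.2275 — 2 statements merged into one kernel-verified Lean document; each statement's English description precedes it below -/
import Mathlib

section
/- Fix integers s_1 ≥ s_2 ≥ … ≥ s_{ν−1} > 0 and r_1 ≥ r_2 ≥ … ≥ r_ν > 0 with Σ_{j=1}^{ν} r_j = Σ_{i=1}^{ν−1} s_i. Then the following are equivalent: (i) s_i > r_i for all i = 1,…,ν−1 (i.e., all entries of the main diagonal of the (ν−1)×ν matrix A = (s_i − r_j) are strictly positive); (ii) there exists a proper homogeneous ideal I ⊆ R of height 2 such that R/I is Cohen–Macaulay, the minimal number of homogeneous generators of I in degree d (that is, dim_K of the degree-d component of I/𝔪I, with 𝔪 = (x_0,…,x_n)) equals #{ j : r_j = d } for every d, and h_{R/I}(k) = h_R(k) − Σ_{j=1}^{ν} h_R(k − r_j) + Σ_{i=1}^{ν−1} h_R(k − s_i) for every integer k. Condition (ii) encodes that I has minimal graded free resolution 0 → ⊕_{i=1}^{ν−1} R(−s_i) → ⊕_{j=1}^{ν} R(−r_j) → I → 0, i.e., I is the saturated ideal of an ACM codimension two subscheme of P^n with this minimal resolution. -/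
open MvPolynomial

noncomputable section

/-- The polynomial ring `K[x_0, ..., x_n]`. -/
abbrev PR (K : Type) [Field K] (n : ℕ) := MvPolynomial (Fin (n + 1)) K

/-- An ideal is homogeneous if it contains all homogeneous components of its elements. -/
def IsHomogIdeal {K : Type} [Field K] {n : ℕ} (I : Ideal (PR K n)) : Prop :=
  ∀ F ∈ I, ∀ d : ℕ, homogeneousComponent d F ∈ I

/-- `F, G` is a regular sequence in `R`: `F` is a nonzerodivisor on `R` and `G` is a
nonzerodivisor on `R/(F)`. -/
def IsRegSeq {K : Type} [Field K] {n : ℕ} (F G : PR K n) : Prop :=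
  IsSMulRegular (PR K n) F ∧
    IsSMulRegular ((PR K n) ⧸ Ideal.span {F}) (Ideal.Quotient.mk (Ideal.span {F}) G)

/-- The height of an ideal: the infimum of the heights of the primes containing it. -/
def idealHeight {A : Type} [CommRing A] (I : Ideal A) : ℕ∞ :=
  ⨅ (P : PrimeSpectrum A) (_ : I ≤ P.asIdeal), Order.height P

/-- The Hilbert function of `R/I`: `h_{R/I}(t) = dim_K R_t - dim_K (I ∩ R_t)`. -/
def hilbQuot {K : Type} [Field K] {n : ℕ} (I : Ideal (PR K n)) (t : ℤ) : ℤ :=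
  if t < 0 then 0 else
    (Module.finrank K (homogeneousSubmodule (Fin (n + 1)) K t.toNat) : ℤ) -
      (Module.finrank K
        ((Submodule.restrictScalars K I) ⊓ homogeneousSubmodule (Fin (n + 1)) K t.toNat :
          Submodule K (PR K n)) : ℤ)

/-- The Hilbert function of the polynomial ring in `n+1` variables. -/
def hPoly (n : ℕ) (k : ℤ) : ℤ := if k < 0 then 0 else (Nat.choose (n + k.toNat) n : ℤ)

/-- The ideal `J` has a free resolution `0 → A^p → A^q → J → 0`. -/
def HasLen1FreeRes {A : Type} [CommRing A] (J : Ideal A) : Prop :=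
  ∃ (p q : ℕ) (f : (Fin p → A) →ₗ[A] (Fin q → A)) (g : (Fin q → A) →ₗ[A] A),
    Function.Injective f ∧ LinearMap.ker g = LinearMap.range f ∧ LinearMap.range g = J

/-- `J` is numerically ACM: some proper homogeneous ideal `J'` of height 2 with `R/J'`
Cohen-Macaulay (equivalently, of projective dimension 2) has the same Hilbert function. -/
def NumACM {K : Type} [Field K] {n : ℕ} (J : Ideal (PR K n)) : Prop :=
  ∃ J' : Ideal (PR K n), J' ≠ ⊤ ∧ IsHomogIdeal J' ∧ idealHeight J' = 2 ∧
    HasLen1FreeRes J' ∧ ∀ t : ℤ, hilbQuot J' t = hilbQuot J t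

/-- `J` is a basic double link of `I` of type `(d, a)`. -/
def IsBDL {K : Type} [Field K] {n : ℕ} (I J : Ideal (PR K n)) (d a : ℕ) : Prop :=
  ∃ F G : PR K n, F ∈ I ∧ F ≠ 0 ∧ F.IsHomogeneous d ∧ 1 ≤ a ∧ G.IsHomogeneous a ∧
    IsRegSeq F G ∧ J = Ideal.span {G} * I + Ideal.span {F}

/-- The first map `R → R ⊕ I`, `x ↦ (G·x, -F·x)`. -/
def bdlα {K : Type} [Field K] {n : ℕ} (I : Ideal (PR K n)) (F G : PR K n) (hF : F ∈ I) :
    PR K n →ₗ[PR K n] (PR K n) × I :=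
  (LinearMap.mulLeft (PR K n) G).prod
    (LinearMap.codRestrict I (LinearMap.mulLeft (PR K n) (-F))
      (fun x => I.mul_mem_right x (I.neg_mem hF)))

/-- The second map `R ⊕ I → R`, `(p, q) ↦ p·F + q·G`. -/
def bdlβ {K : Type} [Field K] {n : ℕ} (I : Ideal (PR K n)) (F G : PR K n) :
    (PR K n) × I →ₗ[PR K n] PR K n :=
  (LinearMap.mulLeft (PR K n) F).comp (LinearMap.fst _ _ _) +
    (LinearMap.mulLeft (PR K n) G).comp (I.subtype.comp (LinearMap.snd _ _ _))
/-- The finite difference operator `(Δf)(k) = f(k) - f(k-1)`. -/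
def deltaOp (f : ℤ → ℤ) : ℤ → ℤ := fun k => f k - f (k - 1)

/-- The number of minimal generators of `I` in degree `d`, i.e. the `K`-dimension of the
degree-`d` component of `I/𝔪I`, computed as `dim_K (I ∩ R_d) - dim_K (𝔪I ∩ R_d)`. -/
def minGensDeg {K : Type} [Field K] {n : ℕ} (I : Ideal (PR K n)) (d : ℕ) : ℤ :=
  (Module.finrank K
      ((Submodule.restrictScalars K I) ⊓ homogeneousSubmodule (Fin (n + 1)) K d :
        Submodule K (PR K n)) : ℤ) -
    (Module.finrank K
      ((Submodule.restrictScalars K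
          (Ideal.span (Set.range (X : Fin (n + 1) → PR K n)) * I)) ⊓
          homogeneousSubmodule (Fin (n + 1)) K d :
        Submodule K (PR K n)) : ℤ)

/-- The ideal `I` is saturated with respect to `𝔪 = (x_0, ..., x_n)`. -/
def IsSatIdeal {K : Type} [Field K] {n : ℕ} (I : Ideal (PR K n)) : Prop :=
  ∀ x : PR K n,
    (∃ k : ℕ, ∀ y ∈ (Ideal.span (Set.range (X : Fin (n + 1) → PR K n))) ^ k, x * y ∈ I) →
      x ∈ I

namespace GradedSyzygy

open Finset

variable {K : Type} [Field K] {n : ℕ}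

/-- The degree-`d` part of the polynomial ring, zero for negative `d`. -/
def gr (K : Type) [Field K] (n : ℕ) (d : ℤ) : Submodule K (PR K n) :=
  if d < 0 then ⊥ else homogeneousSubmodule (Fin (n + 1)) K d.toNat

/-- The degree-`d` component of a polynomial, zero for negative `d`. -/
def hc (d : ℤ) : PR K n →ₗ[K] PR K n :=
  if d < 0 then 0 else homogeneousComponent d.toNat

lemma coeff_hc (d : ℤ) (p : PR K n) (u : Fin (n + 1) →₀ ℕ) :
    coeff u (hc d p) = if (u.degree : ℤ) = d then coeff u p else 0 := by
  unfold hc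
  split_ifs with h1 h2 h2
  · omega
  · simp
  · rw [coeff_homogeneousComponent, if_pos (by omega)]
  · rw [coeff_homogeneousComponent, if_neg (by omega)]

lemma hc_hc (d : ℤ) (p : PR K n) : hc d (hc d p) = hc d p := by
  ext u
  simp only [coeff_hc]
  split_ifs <;> rfl

lemma mem_gr {d : ℤ} {p : PR K n} : p ∈ gr K n d ↔ hc d p = p := by
  unfold gr hc
  split_ifs with h
  · simp [eq_comm]
  · refine ⟨fun hp => homogeneousComponent_eq_self hp, fun hp => ?_⟩
    rw [← hp]
    exact homogeneousComponent_isHomogeneous _ _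

lemma hc_mem (d : ℤ) (p : PR K n) : hc d p ∈ gr K n d := mem_gr.2 (hc_hc d p)

lemma degree_eq_of_mem_gr {d : ℤ} {p : PR K n} (hp : p ∈ gr K n d) {u : Fin (n + 1) →₀ ℕ}
    (hu : coeff u p ≠ 0) : (u.degree : ℤ) = d := by
  by_contra h
  rw [mem_gr] at hp
  rw [← hp, coeff_hc, if_neg h] at hu
  exact hu rfl

lemma hc_mul {e : ℤ} {g : PR K n} (hg : g ∈ gr K n e) (d : ℤ) (a : PR K n) :
    hc d (a * g) = hc (d - e) a * g := by
  ext u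
  rw [coeff_hc, coeff_mul, coeff_mul]
  have key : ∀ x ∈ antidiagonal u, coeff x.1 (hc (d - e) a) * coeff x.2 g =
      if (u.degree : ℤ) = d then coeff x.1 a * coeff x.2 g else 0 := by
    intro x hx
    by_cases h0 : coeff x.2 g = 0
    · simp [h0]
    · have h1 := degree_eq_of_mem_gr hg h0
      have h2 : x.1.degree + x.2.degree = u.degree := by
        rw [← mem_antidiagonal.1 hx, map_add]
      rw [coeff_hc]
      by_cases h3 : (u.degree : ℤ) = d
      · rw [if_pos h3, if_pos (by omega)]
      · rw [if_neg h3, if_neg (by omega), zero_mul]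
  rw [sum_congr rfl key]
  split_ifs <;> simp

lemma mul_mem_gr {d e : ℤ} {a b : PR K n} (ha : a ∈ gr K n d) (hb : b ∈ gr K n e) :
    a * b ∈ gr K n (d + e) := by
  rw [mem_gr, hc_mul hb, add_sub_cancel_right, mem_gr.1 ha]

lemma prod_mem_gr {ι : Type*} (s : Finset ι) (f : ι → PR K n) (d : ι → ℤ)
    (h : ∀ i ∈ s, f i ∈ gr K n (d i)) : ∏ i ∈ s, f i ∈ gr K n (∑ i ∈ s, d i) := by
  classical
  induction s using Finset.induction_on with
  | empty =>
    rw [prod_empty, sum_empty, gr, if_neg (lt_irrefl 0)]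
    exact isHomogeneous_one (Fin (n + 1)) K
  | insert a s ha ih =>
    rw [prod_insert ha, sum_insert ha]
    exact mul_mem_gr (h a (mem_insert_self a s)) (ih fun i hi => h i (mem_insert_of_mem hi))

lemma X_pow_mem_gr (i : Fin (n + 1)) (d : ℤ) (hd : 0 ≤ d) :
    (X i ^ d.toNat : PR K n) ∈ gr K n d := by
  rw [gr, if_neg (by omega)]
  exact isHomogeneous_X_pow i _

lemma sum_hc (p : PR K n) :
    p = ∑ d ∈ range (p.totalDegree + 1), hc (d : ℤ) p := by
  conv_lhs => rw [← sum_homogeneousComponent p]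
  refine sum_congr rfl fun d _ => ?_
  rw [hc, if_neg (by omega), Int.toNat_natCast]

lemma hc_zero (p : PR K n) : hc 0 p = C (constantCoeff p) := by
  simp [hc, constantCoeff_eq]

lemma constantCoeff_hc {d : ℤ} (hd : d ≠ 0) (p : PR K n) : constantCoeff (hc d p) = 0 := by
  rw [constantCoeff_eq, coeff_hc, if_neg]
  simpa using hd.symm

lemma gr_neg {d : ℤ} (hd : d < 0) : gr K n d = ⊥ := if_pos hd

lemma gr_of_nonneg {d : ℤ} (hd : 0 ≤ d) :
    gr K n d = homogeneousSubmodule (Fin (n + 1)) K d.toNat := if_neg (by omega)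

lemma homogeneousComponent_eq_hc (d : ℕ) (p : PR K n) : homogeneousComponent d p = hc (d : ℤ) p := by
  rw [hc, if_neg (by omega), Int.toNat_natCast]

instance (d : ℤ) : Module.Finite K (gr K n d) := by
  rw [Module.Finite.iff_fg]
  rcases lt_or_ge d 0 with h | h
  · rw [gr_neg h]
    exact Submodule.fg_bot
  · rw [gr_of_nonneg h]
    exact homogeneousSubmodule_fg (Fin (n + 1)) K d.toNat

lemma finrank_gr (d : ℤ) : (Module.finrank K (gr K n d) : ℤ) = hPoly n d := by
  rcases lt_or_ge d 0 with h | h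
  · rw [gr_neg h, hPoly, if_pos h]
    simp
  · rw [gr_of_nonneg h, hPoly, if_neg (by omega), homogeneousSubmodule_eq_finsupp_supported]
    have hset : {u : Fin (n + 1) →₀ ℕ | u.degree = d.toNat} =
        ↑(finsuppAntidiag (univ : Finset (Fin (n + 1))) d.toNat) := by
      ext u
      simp [Finsupp.degree_eq_sum, mem_finsuppAntidiag]
    have e := (AddMonoidAlgebra.supportedEquivFinsupp (S := K) (R := K)
      {u : Fin (n + 1) →₀ ℕ | u.degree = d.toNat}).finrank_eq
    refine (congrArg Nat.cast e).trans ?_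
    rw [hset, Module.finrank_finsupp_self]
    simp only [Finset.coe_sort_coe, Fintype.card_coe]
    rw [card_finsuppAntidiag_nat_eq_choose]
    congr 1
    rw [card_univ, Fintype.card_fin, Nat.add_right_comm, Nat.add_sub_cancel,
      Nat.choose_symm_add]

lemma mem_span_range_X {p : PR K n} :
    p ∈ Ideal.span (Set.range (X : Fin (n + 1) → PR K n)) ↔ constantCoeff p = 0 := by
  rw [← Set.image_univ, mem_ideal_span_X_image]
  constructor
  · intro h
    rw [constantCoeff_eq]
    by_contra h0
    obtain ⟨i, _, hi⟩ := h 0 (mem_support_iff.2 h0)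
    exact hi rfl
  · intro h u hu
    have : u ≠ 0 := by
      rintro rfl
      exact mem_support_iff.1 hu h
    obtain ⟨i, hi⟩ := Finsupp.ne_iff.1 this
    exact ⟨i, trivial, hi⟩

/-- A finite family with no relation having a coefficient outside the irrelevant ideal. -/
def IsMinimalFamily (K : Type) [Field K] (n : ℕ) {M ι : Type*} [Fintype ι] [AddCommGroup M] [Module (PR K n) M]
    (z : ι → M) : Prop :=
  ∀ a : ι → PR K n, ∑ i, a i • z i = 0 → ∀ i, constantCoeff (a i) = 0

/-- A submodule of a graded module (with degree components `c`) containing the components of its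
elements is generated by a minimal finite family of homogeneous elements. -/
lemma exists_minimal_homogeneous_generators {M : Type*} [AddCommGroup M] [Module (PR K n) M]
    [IsNoetherian (PR K n) M] (c : ℤ → M →+ M) (hidem : ∀ d v, c d (c d v) = c d v)
    (hmul : ∀ e v, c e v = v → ∀ (a : PR K n) d, c d (a • v) = hc (d - e) a • v)
    (hsum : ∀ v, ∃ t : Finset ℤ, v = ∑ d ∈ t, c d v)
    (N : Submodule (PR K n) M) (hN : ∀ v ∈ N, ∀ d, c d v ∈ N) :
    ∃ (q : ℕ) (z : Fin q → M) (e : Fin q → ℤ), (∀ i, c (e i) (z i) = z i) ∧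
      Submodule.span (PR K n) (Set.range z) = N ∧ IsMinimalFamily K n z := by
  classical
  let P : ℕ → Prop := fun q => ∃ (z : Fin q → M) (e : Fin q → ℤ), (∀ i, c (e i) (z i) = z i) ∧
      Submodule.span (PR K n) (Set.range z) = N
  have of_finset : ∀ t : Finset M, (∀ v ∈ t, ∃ e, c e v = v) →
      Submodule.span (PR K n) (t : Set M) = N → P #t := by
    intro t ht hspan
    choose! e he using ht
    refine ⟨fun i => (t.equivFin.symm i : M), fun i => e (t.equivFin.symm i),
      fun i => he _ (t.equivFin.symm i).2, ?_⟩
    rw [← hspan]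
    congr 1
    ext v
    constructor
    · rintro ⟨i, rfl⟩
      exact (t.equivFin.symm i).2
    · intro hv
      exact ⟨t.equivFin ⟨v, hv⟩, by simp⟩
  have hex : ∃ q, P q := by
    obtain ⟨t, ht⟩ := IsNoetherian.noetherian N
    choose u hu using hsum
    refine ⟨_, of_finset (t.biUnion fun v => (u v).image fun d => c d v) ?_ ?_⟩
    · intro w hw
      simp only [mem_biUnion, mem_image] at hw
      obtain ⟨v, -, d, -, rfl⟩ := hw
      exact ⟨d, hidem d v⟩
    · apply le_antisymm
      · rw [Submodule.span_le]
        intro w hw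
        simp only [coe_biUnion, Set.mem_iUnion, coe_image] at hw
        obtain ⟨v, hv, d, -, rfl⟩ := hw
        exact hN v (ht ▸ Submodule.subset_span hv) d
      · rw [← ht, Submodule.span_le]
        intro v hv
        rw [SetLike.mem_coe, hu v]
        refine Submodule.sum_mem _ fun d hd => Submodule.subset_span ?_
        simp only [coe_biUnion, Set.mem_iUnion, coe_image]
        exact ⟨v, hv, d, hd, rfl⟩
  obtain ⟨z, e, hz, hspan⟩ := Nat.find_spec hex
  refine ⟨_, z, e, hz, hspan, fun a ha k => ?_⟩
  by_contra h0
  have h1 : ∑ i, hc (e k - e i) (a i) • z i = 0 := by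
    rw [← map_zero (c (e k)), ← ha, map_sum]
    exact sum_congr rfl fun i _ => (hmul _ _ (hz i) _ _).symm
  have hk : z k ∈ Submodule.span (PR K n) ((univ.erase k).image z : Set M) := by
    rw [← add_sum_erase _ _ (mem_univ k), sub_self, hc_zero] at h1
    have h2 : z k = (C (constantCoeff (a k))⁻¹ : PR K n) •
        -∑ i ∈ univ.erase k, hc (e k - e i) (a i) • z i := by
      rw [← eq_neg_of_add_eq_zero_left h1, smul_smul, ← C_mul, inv_mul_cancel₀ h0, C_1, one_smul]
    rw [h2]
    refine Submodule.smul_mem _ _ (Submodule.neg_mem _ (Submodule.sum_mem _ fun i hi =>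
      Submodule.smul_mem _ _ (Submodule.subset_span ?_)))
    exact mem_coe.2 (mem_image_of_mem z hi)
  have hP : P #((univ.erase k).image z) := by
    refine of_finset _ ?_ ?_
    · intro v hv
      obtain ⟨i, -, rfl⟩ := mem_image.1 hv
      exact ⟨e i, hz i⟩
    · rw [← hspan]
      apply le_antisymm
      · apply Submodule.span_mono
        intro v hv
        obtain ⟨i, -, rfl⟩ := mem_image.1 (mem_coe.1 hv)
        exact ⟨i, rfl⟩
      · rw [Submodule.span_le]
        rintro _ ⟨i, rfl⟩
        by_cases hik : i = k
        · exact hik ▸ hk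
        · exact Submodule.subset_span
            (mem_coe.2 (mem_image_of_mem z (mem_erase.2 ⟨hik, mem_univ i⟩)))
  have h3 := Nat.find_min' hex hP
  have h4 : #((univ.erase k).image z) ≤ #((univ : Finset (Fin (Nat.find hex))).erase k) :=
    card_image_le
  rw [card_erase_of_mem (mem_univ k), card_univ, Fintype.card_fin] at h4
  have := k.pos
  omega

/-- Minimal generators of a projective module over the polynomial ring form a basis. -/
lemma IsMinimalFamily.linearIndependent {M : Type*} [AddCommGroup M] [Module (PR K n) M]
    {q : ℕ} {z : Fin q → M} (hz : IsMinimalFamily K n z)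
    [hproj : Module.Projective (PR K n) (Submodule.span (PR K n) (Set.range z))] :
    LinearIndependent (PR K n) z := by
  let N := Submodule.span (PR K n) (Set.range z)
  let z' : Fin q → N := fun i => ⟨z i, Submodule.subset_span ⟨i, rfl⟩⟩
  let π : (Fin q → PR K n) →ₗ[PR K n] N := Fintype.linearCombination (PR K n) z'
  have hπ : ∀ a, (π a : M) = ∑ i, a i • z i := by
    intro a
    simp [π, Fintype.linearCombination_apply, z']
  have hsurj : Function.Surjective π := by
    rintro ⟨v, hv⟩
    obtain ⟨a, ha⟩ := (Submodule.mem_span_range_iff_exists_fun _).1 hv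
    exact ⟨a, Subtype.ext ((hπ a).trans ha)⟩
  obtain ⟨τ, hτ⟩ := Module.projective_lifting_property π LinearMap.id hsurj
  have hτ' : ∀ v, π (τ v) = v := fun v => LinearMap.congr_fun hτ v
  let L := LinearMap.ker π
  have hL : L ≤ Ideal.span (Set.range (X : Fin (n + 1) → PR K n)) • L := by
    intro a ha
    have ha0 : π a = 0 := ha
    have hconst := hz a (by rw [← hπ, ha0]; rfl)
    have hdec : a = ∑ i, a i • (Pi.single i 1 - τ (π (Pi.single i 1))) := by
      have h1 : a = a - τ (π a) := by rw [ha0, map_zero, sub_zero]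
      have h2 : a = ∑ i, a i • (Pi.single i 1 : Fin q → PR K n) := pi_eq_sum_univ' a
      conv_lhs => rw [h1, h2]
      simp only [map_sum, map_smul, smul_sub, sum_sub_distrib]
    rw [hdec]
    refine Submodule.sum_mem _ fun i _ => Submodule.smul_mem_smul
      (mem_span_range_X.2 (hconst i)) ?_
    change π _ = 0
    rw [map_sub, hτ', sub_self]
  obtain ⟨ρ, hρ1, hρ2⟩ := Submodule.exists_sub_one_mem_and_smul_eq_zero_of_fg_of_le_smul _ L
    (IsNoetherian.noetherian L) hL
  rw [mem_span_range_X, map_sub, map_one, sub_eq_zero] at hρ1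
  have hρ0 : ρ ≠ 0 := by
    rintro rfl
    simp at hρ1
  rw [Fintype.linearIndependent_iff]
  intro a ha i
  have haL : a ∈ L := Subtype.ext ((hπ a).trans ha)
  exact (mul_eq_zero.1 (congrFun (hρ2 a haL) i)).resolve_left hρ0

/-- If an image of a free module has a free resolution of length one, the kernel is projective. -/
lemma HasLen1FreeRes.projective_ker {A : Type} [CommRing A] {p : ℕ}
    (g : (Fin p → A) →ₗ[A] A) (h : HasLen1FreeRes (LinearMap.range g)) :
    Module.Projective A (LinearMap.ker g) := by
  obtain ⟨p', q', f, g', hf, hker, hrange⟩ := h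
  obtain ⟨φ, hφ⟩ := Module.projective_lifting_property g.rangeRestrict
    (g'.codRestrict (LinearMap.range g) fun x => hrange ▸ LinearMap.mem_range_self g' x)
    g.surjective_rangeRestrict
  have hφ' : ∀ x, g (φ x) = g' x := fun x => congrArg Subtype.val (LinearMap.congr_fun hφ x)
  obtain ⟨ψ, hψ⟩ := Module.projective_lifting_property g'.rangeRestrict
    (g.codRestrict (LinearMap.range g') fun x => hrange ▸ LinearMap.mem_range_self g x)
    g'.surjective_rangeRestrict
  have hψ' : ∀ x, g' (ψ x) = g x := fun x => congrArg Subtype.val (LinearMap.congr_fun hψ x)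
  have hgf : ∀ y, g' (f y) = 0 := fun y =>
    (hker ▸ LinearMap.mem_range_self f y : f y ∈ LinearMap.ker g')
  let fe := LinearEquiv.ofInjective f hf
  let i : LinearMap.ker g →ₗ[A] (Fin p → A) × (Fin p' → A) :=
    (LinearMap.ker g).subtype.prod (fe.symm.toLinearMap ∘ₗ
      (ψ ∘ₗ (LinearMap.ker g).subtype).codRestrict (LinearMap.range f) fun z => by
        rw [← hker, LinearMap.mem_ker, LinearMap.comp_apply, hψ']
        exact z.2)
  let s : (Fin p → A) × (Fin p' → A) →ₗ[A] LinearMap.ker g :=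
    ((LinearMap.id - φ ∘ₗ ψ).coprod (φ ∘ₗ f)).codRestrict (LinearMap.ker g) fun x => by
      simp [hφ', hψ', hgf]
  refine Module.Projective.of_split i s (LinearMap.ext fun z => Subtype.ext ?_)
  have hfe : ∀ y : LinearMap.range f, f (fe.symm y) = y := fun y =>
    congrArg Subtype.val (fe.apply_symm_apply y)
  change ((z : Fin p → A) - φ (ψ z)) + φ (f (fe.symm _)) = z
  rw [hfe]
  simp

/-- Shifted Hilbert functions of polynomial rings determine the shifts. -/
lemma card_filter_le_of_sum_hPoly {ι κ : Type*} [Fintype ι] [Fintype κ] (a : ι → ℤ) (b : κ → ℤ)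
    (n : ℕ) (h : ∀ k, ∑ i, hPoly n (k - a i) = ∑ j, hPoly n (k - b j)) (k : ℤ) :
    #{i | a i ≤ k} = #{j | b j ≤ k} := by
  induction n with
  | zero =>
    have h0 : ∀ d, hPoly 0 d = if 0 ≤ d then 1 else 0 := by
      intro d
      unfold hPoly
      split_ifs <;> first | omega | simp
    have := h k
    simp only [h0, sub_nonneg, sum_boole] at this
    exact_mod_cast this
  | succ n ih =>
    refine ih fun k => ?_
    have pascal : ∀ d, hPoly n d = hPoly (n + 1) d - hPoly (n + 1) (d - 1) := by
      intro d
      unfold hPoly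
      rcases lt_trichotomy d 0 with hd | rfl | hd
      · simp [hd, hd.trans_le zero_le_one]
      · simp
      · obtain ⟨m, rfl⟩ : ∃ m : ℕ, d = m + 1 := ⟨(d - 1).toNat, by omega⟩
        have e1 : ((m : ℤ) + 1).toNat = m + 1 := by omega
        have e2 : ((m : ℤ) + 1 - 1).toNat = m := by omega
        rw [if_neg (by omega), if_neg (by omega), if_neg (by omega), e1, e2,
          show n + 1 + (m + 1) = (n + (m + 1)) + 1 by ring, Nat.choose_succ_succ,
          show n + 1 + m = n + (m + 1) by ring]
        push_cast
        ring
    simp only [pascal, sum_sub_distrib]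
    rw [h k]
    congr 1
    simpa only [sub_right_comm] using h (k - 1)

lemma minGensDeg_span {p : ℕ} {g : Fin p → PR K n} {e : Fin p → ℤ}
    (hg : ∀ j, g j ∈ gr K n (e j)) (hmin : IsMinimalFamily K n g) (d : ℕ) :
    minGensDeg (Ideal.span (Set.range g)) d = #{j | e j = (d : ℤ)} := by
  classical
  set I := Ideal.span (Set.range g) with hI
  set s : Finset (Fin p) := {j | e j = (d : ℤ)} with hs
  have hsm : ∀ {j}, j ∈ s ↔ e j = d := by simp [hs]
  unfold minGensDeg
  rw [show homogeneousSubmodule (Fin (n + 1)) K d = gr K n (d : ℤ) from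
    (gr_of_nonneg (Int.natCast_nonneg d)).symm]
  set A : Submodule K (PR K n) := Submodule.restrictScalars K
    (Ideal.span (Set.range (X : Fin (n + 1) → PR K n)) * I) ⊓ gr K n d with hA
  set B : Submodule K (PR K n) := Submodule.span K (g '' (s : Set (Fin p))) with hB
  have hBfin : FiniteDimensional K B := FiniteDimensional.span_of_finite K (Set.toFinite _)
  have hgI : ∀ j, g j ∈ I := fun j => Ideal.subset_span ⟨j, rfl⟩
  have key : ∀ c : Fin p → K, (∑ j ∈ s, c j • g j) ∈
      Ideal.span (Set.range (X : Fin (n + 1) → PR K n)) * I → ∀ j ∈ s, c j = 0 := by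
    intro c hc' j hj
    rw [← smul_eq_mul, hI, Ideal.span, Submodule.mem_ideal_smul_span_iff_exists_sum] at hc'
    obtain ⟨b, hb, hbc⟩ := hc'
    rw [Finsupp.sum_fintype _ _ (by simp)] at hbc
    have h1 := hmin (fun i => (if i ∈ s then C (c i) else 0) - b i) (by
      simp only [sub_smul, sum_sub_distrib, hbc, ite_smul, zero_smul, sum_ite_mem, univ_inter,
        sub_eq_zero]
      exact sum_congr rfl fun i _ => by rw [smul_eq_C_mul, smul_eq_mul]) j
    rw [if_pos hj, map_sub, constantCoeff_C, mem_span_range_X.1 (hb j), sub_zero] at h1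
    exact h1
  have hBmem : ∀ F ∈ B, ∃ c : Fin p → K, ∑ j ∈ s, c j • g j = F := by
    intro F hF
    obtain ⟨c, rfl⟩ := (Submodule.mem_span_image_finset_iff_exists_fun K).1 hF
    refine ⟨fun i => if h : i ∈ s then c ⟨i, h⟩ else 0, ?_⟩
    rw [← sum_coe_sort]
    exact sum_congr rfl fun i _ => by simp
  have hinf : A ⊓ B = ⊥ := by
    rw [eq_bot_iff]
    rintro F ⟨⟨hF1, -⟩, hF2⟩
    obtain ⟨c, rfl⟩ := hBmem F hF2
    rw [Submodule.mem_bot]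
    exact sum_eq_zero fun j hj => by rw [key c hF1 j hj, zero_smul]
  have hsup : Submodule.restrictScalars K I ⊓ gr K n d = A ⊔ B := by
    apply le_antisymm
    · rintro F ⟨hF1, hF2⟩
      obtain ⟨a, ha⟩ := Ideal.mem_span_range_iff_exists_fun.1 hF1
      have h1 : F = ∑ j, hc (d - e j) (a j) * g j := by
        conv_lhs => rw [← mem_gr.1 hF2, ← ha, map_sum]
        exact sum_congr rfl fun j _ => hc_mul (hg j) _ _
      rw [h1]
      refine Submodule.sum_mem _ fun j _ => ?_
      by_cases hj : e j = d
      · refine Submodule.mem_sup_right ?_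
        rw [hj, sub_self, hc_zero, ← smul_eq_C_mul]
        exact Submodule.smul_mem _ _ (Submodule.subset_span ⟨j, mem_coe.2 (hsm.2 hj), rfl⟩)
      · refine Submodule.mem_sup_left ⟨Ideal.mul_mem_mul (mem_span_range_X.2
          (constantCoeff_hc (by omega) _)) (hgI j), ?_⟩
        have := mul_mem_gr (hc_mem (d - e j) (a j)) (hg j)
        rwa [sub_add_cancel] at this
    · have hle : Ideal.span (Set.range (X : Fin (n + 1) → PR K n)) * I ≤ I := Ideal.mul_le_right
      refine sup_le (fun F hF => ⟨hle hF.1, hF.2⟩) ?_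
      rw [hB, Submodule.span_le]
      rintro _ ⟨j, hj, rfl⟩
      exact ⟨hgI j, hsm.1 (mem_coe.1 hj) ▸ hg j⟩
  have hBrank : Module.finrank K B = #s := by
    have hli : LinearIndepOn K g (s : Set (Fin p)) := by
      rw [linearIndepOn_finset_iff]
      intro c h0
      exact key c (h0 ▸ zero_mem _)
    have := finrank_span_eq_card hli
    rw [Set.range_comp', Subtype.range_coe] at this
    simpa using this
  have hAfin : FiniteDimensional K A := Submodule.finiteDimensional_inf_right _ _
  have hadd := Submodule.finrank_sup_add_finrank_inf_eq A B
  rw [hinf, finrank_bot, hBrank] at hadd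
  rw [hsup, sub_eq_iff_eq_add', ← Nat.cast_add, ← hadd, add_zero]

lemma isHomogIdeal_span {p : ℕ} {g : Fin p → PR K n} {e : Fin p → ℤ}
    (hg : ∀ j, g j ∈ gr K n (e j)) : IsHomogIdeal (Ideal.span (Set.range g)) := by
  intro F hF d
  obtain ⟨a, rfl⟩ := Ideal.mem_span_range_iff_exists_fun.1 hF
  rw [homogeneousComponent_eq_hc, map_sum]
  refine Ideal.sum_mem _ fun j _ => ?_
  rw [hc_mul (hg j)]
  exact Ideal.mul_mem_left _ _ (Ideal.subset_span ⟨j, rfl⟩)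

/-- The Hilbert function of an ideal with a graded free resolution of length one. -/
lemma hilbQuot_span {p q : ℕ} {g : Fin p → PR K n} {e : Fin p → ℤ}
    (hg : ∀ j, g j ∈ gr K n (e j)) {z : Fin q → Fin p → PR K n} {s : Fin q → ℤ}
    (hz : ∀ i j, z i j ∈ gr K n (s i - e j)) (hli : LinearIndependent (PR K n) z)
    (hrel : ∀ i, ∑ j, z i j * g j = 0)
    (hker : ∀ a : Fin p → PR K n, ∑ j, a j * g j = 0 → ∃ c : Fin q → PR K n, ∑ i, c i • z i = a)
    (k : ℤ) :
    hilbQuot (Ideal.span (Set.range g)) k =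
      hPoly n k - ∑ j, hPoly n (k - e j) + ∑ i, hPoly n (k - s i) := by
  have hfin : hilbQuot (Ideal.span (Set.range g)) k = hPoly n k -
      (Module.finrank K (Submodule.restrictScalars K (Ideal.span (Set.range g)) ⊓ gr K n k :
        Submodule K (PR K n)) : ℤ) := by
    unfold hilbQuot
    rcases lt_or_ge k 0 with h | h
    · rw [if_pos h, gr_neg h, inf_bot_eq, finrank_bot, hPoly, if_pos h]
      simp
    · rw [if_neg (by omega), ← gr_of_nonneg h, finrank_gr]
  let Φ : (∀ j, gr K n (k - e j)) →ₗ[K] PR K n :=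
    ∑ j, LinearMap.mulRight K (g j) ∘ₗ (gr K n (k - e j)).subtype ∘ₗ LinearMap.proj j
  have hΦ : ∀ a, Φ a = ∑ j, (a j : PR K n) * g j := by
    intro a
    simp [Φ]
  have hΦr : LinearMap.range Φ =
      Submodule.restrictScalars K (Ideal.span (Set.range g)) ⊓ gr K n k := by
    apply le_antisymm
    · rintro _ ⟨a, rfl⟩
      rw [hΦ]
      refine ⟨Ideal.mem_span_range_iff_exists_fun.2 ⟨_, rfl⟩, Submodule.sum_mem _ fun j _ => ?_⟩
      have := mul_mem_gr (a j).2 (hg j)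
      rwa [sub_add_cancel] at this
    · rintro F ⟨hF1, hF2⟩
      obtain ⟨a, rfl⟩ := Ideal.mem_span_range_iff_exists_fun.1 hF1
      refine ⟨fun j => ⟨hc (k - e j) (a j), hc_mem _ _⟩, ?_⟩
      rw [hΦ]
      conv_rhs => rw [← mem_gr.1 hF2, map_sum]
      exact sum_congr rfl fun j _ => (hc_mul (hg j) _ _).symm
  let Ψ : (∀ i, gr K n (k - s i)) →ₗ[K] ∀ j, gr K n (k - e j) :=
    LinearMap.pi fun j => LinearMap.codRestrict (gr K n (k - e j))
      (∑ i, LinearMap.mulRight K (z i j) ∘ₗ (gr K n (k - s i)).subtype ∘ₗ LinearMap.proj i)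
      fun c => by
        rw [LinearMap.sum_apply]
        refine Submodule.sum_mem _ fun i _ => ?_
        have := mul_mem_gr (c i).2 (hz i j)
        rwa [sub_add_sub_cancel] at this
  have hΨ : ∀ c j, (Ψ c j : PR K n) = ∑ i, (c i : PR K n) * z i j := by
    intro c j
    simp [Ψ]
  have hΨinj : Function.Injective Ψ := by
    rw [← LinearMap.ker_eq_bot, LinearMap.ker_eq_bot']
    intro c h0
    have := Fintype.linearIndependent_iff.1 hli (fun i => (c i : PR K n)) (by
      ext1 j
      rw [Finset.sum_apply]
      exact (hΨ c j).symm.trans (by rw [h0]; rfl))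
    exact funext fun i => Subtype.ext (this i)
  have hΨr : LinearMap.range Ψ = LinearMap.ker Φ := by
    apply le_antisymm
    · rintro _ ⟨c, rfl⟩
      rw [LinearMap.mem_ker, hΦ]
      simp only [hΨ, sum_mul]
      rw [sum_comm]
      refine sum_eq_zero fun i _ => ?_
      simp only [mul_assoc]
      rw [← mul_sum, hrel, mul_zero]
    · intro a ha
      rw [LinearMap.mem_ker, hΦ] at ha
      obtain ⟨c, hca⟩ := hker (fun j => a j) ha
      refine ⟨fun i => ⟨hc (k - s i) (c i), hc_mem _ _⟩, funext fun j => Subtype.ext ?_⟩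
      rw [hΨ, ← mem_gr.1 (a j).2, ← congrFun hca j, Finset.sum_apply, map_sum]
      refine sum_congr rfl fun i _ => ?_
      rw [Pi.smul_apply, smul_eq_mul, hc_mul (hz i j), sub_sub_sub_cancel_right]
  have h1 := LinearMap.finrank_range_add_finrank_ker Φ
  rw [← hΨr, LinearMap.finrank_range_of_inj hΨinj, hΦr, Module.finrank_pi_fintype,
    Module.finrank_pi_fintype] at h1
  rw [hfin]
  zify at h1
  simp only [finrank_gr] at h1
  linarith

lemma eq_zero_of_mem_gr_of_nonpos {d : ℤ} (hd : d ≤ 0) {p : PR K n} (hp : p ∈ gr K n d)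
    (h0 : constantCoeff p = 0) : p = 0 := by
  rcases hd.lt_or_eq with hd | rfl
  · rwa [gr_neg hd, Submodule.mem_bot] at hp
  · rw [← mem_gr.1 hp, hc_zero, h0, C_0]

/-- Independent relations among nonzero elements supported on few coordinates are few. -/
lemma card_lt_card_of_relations {A : Type*} [CommRing A] [IsDomain A] {p q : ℕ} {g : Fin p → A}
    (hg : ∀ j, g j ≠ 0) {z : Fin q → Fin p → A} (hli : LinearIndependent A z)
    (hrel : ∀ i, ∑ j, z i j * g j = 0) {D : Finset (Fin q)} (hD : D.Nonempty)
    {C : Finset (Fin p)} (hzero : ∀ i ∈ D, ∀ j ∉ C, z i j = 0) : #D < #C := by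
  by_contra! hcard
  obtain ⟨ι⟩ : Nonempty (C ↪ D) := Function.Embedding.nonempty_of_card_le (by simpa using hcard)
  let M : Matrix C C A := fun a b => z (ι a) b
  have hC : ∃ j, j ∈ C := by
    obtain ⟨i, hi⟩ := hD
    obtain ⟨j, hj⟩ := Function.ne_iff.1 (hli.ne_zero i)
    exact ⟨j, by_contra fun h => hj (hzero i hi j h)⟩
  have hdet : M.det = 0 := by
    rw [← Matrix.exists_mulVec_eq_zero_iff]
    refine ⟨fun b => g b, ?_, ?_⟩
    · obtain ⟨j, hj⟩ := hC
      exact fun h => hg j (congrFun h ⟨j, hj⟩)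
    · ext a
      rw [Pi.zero_apply, ← hrel (ι a)]
      change ∑ b : C, z (ι a) b * g b = _
      rw [sum_coe_sort C (fun b => z (ι a) b * g b)]
      exact sum_subset (subset_univ C) fun j _ hj => by rw [hzero _ (ι a).2 j hj, zero_mul]
  obtain ⟨w, hw, hwM⟩ := Matrix.exists_vecMul_eq_zero_iff.2 hdet
  have hli' : LinearIndependent A fun a : C => z (ι a) :=
    hli.comp (fun a : C => (ι a : Fin q)) (Subtype.val_injective.comp ι.injective)
  refine hw (funext fun a => Fintype.linearIndependent_iff.1 hli' w ?_ a)
  ext j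
  rw [Finset.sum_apply]
  by_cases hj : j ∈ C
  · exact congrFun hwM ⟨j, hj⟩
  · exact sum_eq_zero fun a _ => by rw [Pi.smul_apply, hzero _ (ι a).2 j hj, smul_zero]

lemma sum_comp_eq_of_card_filter_eq {ι κ : Type*} [Fintype ι] [Fintype κ] {a : ι → ℤ} {b : κ → ℤ}
    (h : ∀ d, #{i | a i = d} = #{j | b j = d}) (f : ℤ → ℤ) : ∑ i, f (a i) = ∑ j, f (b j) := by
  have hM : Multiset.map a univ.val = Multiset.map b univ.val := by
    ext d
    rw [Multiset.count_map, Multiset.count_map]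
    simpa only [eq_comm, Finset.card, filter_val] using h d
  change (Multiset.map (f ∘ a) univ.val).sum = (Multiset.map (f ∘ b) univ.val).sum
  simpa only [Multiset.map_map] using congrArg (fun M => (Multiset.map f M).sum) hM

lemma IsMinimalFamily.ne_zero {M ι : Type*} [Fintype ι] [AddCommGroup M] [Module (PR K n) M]
    {z : ι → M} (hz : IsMinimalFamily K n z) (i : ι) : z i ≠ 0 := by
  classical
  intro h
  have := hz (Pi.single i 1) (sum_eq_zero fun j _ => by
    by_cases hj : j = i
    · rw [hj, h, smul_zero]
    · rw [Pi.single_eq_of_ne hj, zero_smul]) i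
  simp at this

/-- The degree components of a vector in a free module whose generators have degrees `e`. -/
def hcVec {p : ℕ} (e : Fin p → ℤ) (d : ℤ) : (Fin p → PR K n) →+ (Fin p → PR K n) where
  toFun v j := hc (d - e j) (v j)
  map_zero' := by ext1; simp
  map_add' _ _ := by ext1; simp

lemma exists_sum_hcVec {p : ℕ} (e : Fin p → ℤ) (v : Fin p → PR K n) :
    ∃ t : Finset ℤ, v = ∑ d ∈ t, hcVec e d v := by
  classical
  let u : Fin p → Finset ℤ := fun j =>
    (range ((v j).totalDegree + 1)).image fun d : ℕ => (d : ℤ) + e j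
  refine ⟨univ.biUnion u, funext fun j => ?_⟩
  rw [Finset.sum_apply]
  change v j = ∑ d ∈ univ.biUnion u, hc (d - e j) (v j)
  rw [← sum_subset (subset_biUnion_of_mem u (mem_univ j)), sum_image (by simp)]
  · simpa only [add_sub_cancel_right] using sum_hc (v j)
  · intro d _ hd
    ext m
    rw [coeff_hc, coeff_zero]
    split_ifs with hm
    · by_contra h0
      refine hd (mem_image.2 ⟨m.degree, mem_range.2 (Nat.lt_succ_of_le ?_), by omega⟩)
      exact le_totalDegree (mem_support_iff.2 h0)
    · rfl

/-- A height two perfect ideal has a minimal graded free resolution of length one. -/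
lemma exists_graded_resolution {I : Ideal (PR K n)} (hI : IsHomogIdeal I)
    (hres : HasLen1FreeRes I) :
    ∃ (p q : ℕ) (g : Fin p → PR K n) (e : Fin p → ℤ) (z : Fin q → Fin p → PR K n) (s : Fin q → ℤ),
      Ideal.span (Set.range g) = I ∧ IsMinimalFamily K n g ∧ (∀ j, g j ∈ gr K n (e j)) ∧
      (∀ i j, z i j ∈ gr K n (s i - e j)) ∧ LinearIndependent (PR K n) z ∧
      (∀ i, ∑ j, z i j * g j = 0) ∧
      ∀ a : Fin p → PR K n, ∑ j, a j * g j = 0 → ∃ c : Fin q → PR K n, ∑ i, c i • z i = a := by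
  obtain ⟨p, g, e, hg, hspan, hmin⟩ := exists_minimal_homogeneous_generators (K := K) (n := n)
    (M := PR K n) (fun d => (hc d).toAddMonoidHom) hc_hc
    (fun e v hv a d => hc_mul (mem_gr.2 hv) d a)
    (fun v => ⟨(range (v.totalDegree + 1)).map Nat.castEmbedding, by
      rw [sum_map]
      exact sum_hc v⟩)
    I fun v hv d => by
      rcases lt_or_ge d 0 with h | h
      · have : hc d v = 0 := by simpa [gr_neg h] using hc_mem d v
        change hc d v ∈ I
        rw [this]
        exact zero_mem I
      · lift d to ℕ using h
        exact homogeneousComponent_eq_hc d v ▸ hI v hv d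
  have hg' : ∀ j, g j ∈ gr K n (e j) := fun j => mem_gr.2 (hg j)
  let G : (Fin p → PR K n) →ₗ[PR K n] PR K n := Fintype.linearCombination (PR K n) g
  have hG : ∀ a, G a = ∑ j, a j * g j := fun a => by
    simp [G, Fintype.linearCombination_apply]
  have hGr : LinearMap.range G = I := (Fintype.range_linearCombination _ _).trans hspan
  obtain ⟨q, z, s, hz, hzspan, hzmin⟩ := exists_minimal_homogeneous_generators (K := K) (n := n)
    (M := Fin p → PR K n) (hcVec e) (fun d v => funext fun j => hc_hc _ _)
    (fun d v hv a k => funext fun j => by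
      change hc (k - e j) (a * v j) = hc (k - d) a * v j
      rw [hc_mul (mem_gr.2 (congrFun hv j)), sub_sub_sub_cancel_right])
    (exists_sum_hcVec e) (LinearMap.ker G) fun v hv d => by
      rw [LinearMap.mem_ker, hG] at hv ⊢
      rw [← map_zero (hc d), ← hv, map_sum]
      exact sum_congr rfl fun j _ => (hc_mul (hg' j) _ _).symm
  have hproj : Module.Projective (PR K n) (LinearMap.ker G) :=
    HasLen1FreeRes.projective_ker G (hGr.symm ▸ hres)
  rw [← hzspan] at hproj
  refine ⟨p, q, g, e, z, s, hspan, hmin, hg', fun i j => mem_gr.2 (congrFun (hz i) j),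
    hzmin.linearIndependent, fun i => ?_, fun a ha => ?_⟩
  · have : z i ∈ LinearMap.ker G := hzspan ▸ Submodule.subset_span ⟨i, rfl⟩
    rwa [LinearMap.mem_ker, hG] at this
  · have : a ∈ LinearMap.ker G := by rwa [LinearMap.mem_ker, hG]
    rwa [← hzspan, Submodule.mem_span_range_iff_exists_fun] at this

lemma lt_of_exists_ideal (m : ℕ) (s : Fin (m + 1) → ℤ) (r : Fin (m + 2) → ℤ)
    (hs : Antitone s) (hr : Antitone r) (hrpos : ∀ j, 0 < r j) {I : Ideal (PR K n)}
    (hI : IsHomogIdeal I) (hres : HasLen1FreeRes I)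
    (hgens : ∀ d : ℕ, minGensDeg I d = (#{j | r j = (d : ℤ)} : ℤ))
    (hhilb : ∀ k : ℤ, hilbQuot I k =
      hPoly n k - ∑ j, hPoly n (k - r j) + ∑ i, hPoly n (k - s i)) (i : Fin (m + 1)) :
    r i.castSucc < s i := by
  obtain ⟨p, q, g, e, z, s', rfl, hmin, hg, hz, hli, hrel, hker⟩ :=
    exists_graded_resolution hI hres
  have he : ∀ j, 0 ≤ e j := by
    intro j
    by_contra! h
    have := hg j
    rw [gr_neg h, Submodule.mem_bot] at this
    exact hmin.ne_zero j this
  have hcount : ∀ d, #{j | e j = d} = #{j | r j = d} := by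
    intro d
    rcases lt_or_ge d 0 with h | h
    · rw [filter_false_of_mem fun j _ => (h.trans_le (he j)).ne',
        filter_false_of_mem fun j _ => (h.trans (hrpos j)).ne', card_empty, card_empty]
    · lift d to ℕ using h
      have := hgens d
      rw [minGensDeg_span hg hmin] at this
      exact_mod_cast this
  have hsum := sum_comp_eq_of_card_filter_eq hcount
  have hs' : ∀ k, ∑ i, hPoly n (k - s' i) = ∑ i, hPoly n (k - s i) := by
    intro k
    have h1 := hhilb k
    rw [hilbQuot_span hg hz hli hrel hker, hsum fun d => hPoly n (k - d)] at h1
    linarith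
  by_contra! hle
  have hDcard := card_filter_le_of_sum_hPoly s' s n hs' (s i)
  have hD : m + 1 - i ≤ #{k | s k ≤ s i} := by
    rw [← Fin.card_Ici]
    exact card_le_card fun k hk => mem_filter.2 ⟨mem_univ k, hs (mem_Ici.1 hk)⟩
  have hC : #{j | e j < s i} ≤ m + 1 - i := by
    have h1 := hsum fun d => if d < s i then 1 else 0
    simp only [sum_boole, Nat.cast_inj] at h1
    have h2 : #(Ioi i.castSucc) = m + 1 - i := by simp
    rw [h1, ← h2]
    refine card_le_card fun j hj => mem_Ioi.2 ?_
    by_contra! h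
    have h3 := (mem_filter.1 hj).2
    have h4 := hr h
    omega
  have hlt : #{k | s' k ≤ s i} < #{j | e j < s i} := by
    refine card_lt_card_of_relations hmin.ne_zero hli hrel ?_ fun k hk j hj => ?_
    · rw [← card_pos, hDcard]
      omega
    · have hk' : s' k ≤ s i := (mem_filter.1 hk).2
      have hj' : s i ≤ e j := by simpa using hj
      exact eq_zero_of_mem_gr_of_nonpos (by omega) (hz k j) (hmin (z k) (hrel k) j)
  omega

section Staircase

variable {A : Type*} [CommRing A]

/-- The maximal minors, up to sign, of the bidiagonal matrix with diagonals `p` and `q`. -/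
def stair {t : ℕ} (p q : Fin t → A) (j : Fin (t + 1)) : A :=
  ∏ i, if i.castSucc < j then p i else q i

/-- The rows, with signs, of the bidiagonal matrix with diagonals `p` and `q`. -/
def syz {t : ℕ} (p q : Fin t → A) (i : Fin t) : Fin (t + 1) → A :=
  Pi.single i.castSucc (p i) - Pi.single i.succ (q i)

lemma sum_syz_mul_stair {t : ℕ} (p q : Fin t → A) (i : Fin t) :
    ∑ j, syz p q i j * stair p q j = 0 := by
  simp only [syz, Pi.sub_apply, sub_mul, sum_sub_distrib, Pi.single_apply, ite_mul, zero_mul,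
    sum_ite_eq', mem_univ, if_true, stair]
  rw [← mul_prod_erase univ _ (mem_univ i), ← mul_prod_erase univ _ (mem_univ i),
    if_neg (lt_irrefl _), if_pos Fin.castSucc_lt_succ, sub_eq_zero]
  rw [mul_left_comm]
  congr 2
  refine prod_congr rfl fun k hk => ?_
  have hki : (k : ℕ) ≠ i := fun h => (mem_erase.1 hk).1 (Fin.ext h)
  have : k.castSucc < i.castSucc ↔ k.castSucc < i.succ := by
    simp only [Fin.lt_def, Fin.val_castSucc, Fin.val_succ]
    omega
  simp only [this]

lemma stair_zero {t : ℕ} (p q : Fin t → A) : stair p q 0 = ∏ i, q i := by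
  simp [stair]

lemma stair_last {t : ℕ} (p q : Fin t → A) : stair p q (Fin.last t) = ∏ i, p i := by
  simp [stair, Fin.castSucc_lt_last]

lemma stair_succ {t : ℕ} (p q : Fin (t + 1) → A) (j : Fin (t + 1)) :
    stair p q j.succ = p 0 * stair (Fin.tail p) (Fin.tail q) j := by
  simp [stair, Fin.prod_univ_succ, Fin.tail, Fin.castSucc_lt_iff_succ_le]

lemma sum_smul_syz_zero {t : ℕ} (p q : Fin (t + 1) → A) (c : Fin (t + 1) → A) :
    (∑ i, c i • syz p q i) 0 = c 0 * p 0 := by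
  simp only [syz, Finset.sum_apply, Fin.sum_univ_succ, Pi.smul_apply, Pi.sub_apply,
    Pi.single_apply, Fin.castSucc_zero, ← Fin.succ_castSucc, (Fin.succ_ne_zero _).symm, if_true,
    if_false, smul_eq_mul, sub_zero, mul_zero, sum_const_zero, add_zero]

lemma sum_smul_syz_succ {t : ℕ} (p q : Fin (t + 1) → A) (c : Fin (t + 1) → A) (j : Fin (t + 1)) :
    (∑ i, c i • syz p q i) j.succ =
      (∑ i, Fin.tail c i • syz (Fin.tail p) (Fin.tail q) i) j - if j = 0 then c 0 * q 0 else 0 := by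
  simp only [Fin.sum_univ_succ, syz, Finset.sum_apply, Pi.smul_apply, Pi.sub_apply,
    Pi.single_apply, Fin.tail, smul_eq_mul, Fin.castSucc_zero, Fin.succ_ne_zero, if_false,
    ← Fin.succ_castSucc, Fin.succ_inj]
  split_ifs <;> ring

lemma linearIndependent_syz [IsDomain A] {t : ℕ} {p : Fin t → A} (q : Fin t → A)
    (hp : ∀ i, p i ≠ 0) : LinearIndependent A (syz p q) := by
  rw [Fintype.linearIndependent_iff]
  induction t with
  | zero => exact fun _ _ i => i.elim0
  | succ t ih =>
    intro c hc
    have h0 : c 0 = 0 := by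
      have := congrFun hc 0
      rw [sum_smul_syz_zero] at this
      exact (mul_eq_zero.1 this).resolve_right (hp 0)
    refine Fin.cases h0 (ih (p := Fin.tail p) (Fin.tail q) (fun i => hp i.succ) (Fin.tail c) (funext fun j => ?_))
    have := congrFun hc j.succ
    rw [sum_smul_syz_succ, h0] at this
    simpa using this

lemma exists_sum_smul_syz [IsDomain A] [DecompositionMonoid A] {t : ℕ} {p q : Fin t → A}
    (hp : ∀ i, p i ≠ 0) (hpq : ∀ i k, IsRelPrime (p i) (q k)) (a : Fin (t + 1) → A)
    (ha : ∑ j, a j * stair p q j = 0) : ∃ c : Fin t → A, ∑ i, c i • syz p q i = a := by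
  induction t with
  | zero =>
    refine ⟨0, funext fun j => ?_⟩
    fin_cases j
    simpa [stair, eq_comm] using ha
  | succ t ih =>
    rw [Fin.sum_univ_succ] at ha
    simp only [stair_succ, stair_zero] at ha
    have hdvd : p 0 ∣ a 0 * ∏ i, q i := by
      rw [eq_neg_of_add_eq_zero_left ha, dvd_neg]
      exact dvd_sum fun j _ => ⟨a j.succ * stair (Fin.tail p) (Fin.tail q) j, by ring⟩
    obtain ⟨b, hb⟩ := (IsRelPrime.prod_right fun k _ => hpq 0 k).dvd_of_dvd_mul_right hdvd
    have hrec : ∑ j, (a j.succ + if j = 0 then b * q 0 else 0) *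
        stair (Fin.tail p) (Fin.tail q) j = 0 := by
      simp only [add_mul, ite_mul, zero_mul, sum_add_distrib, sum_ite_eq', mem_univ,
        if_true, stair_zero]
      refine mul_left_cancel₀ (hp 0) ?_
      rw [mul_zero, ← ha, hb, Fin.prod_univ_succ, mul_add, mul_sum, add_comm]
      congr 1
      · simp only [Fin.tail_def]
        ring
      · exact sum_congr rfl fun j _ => by ring
    obtain ⟨c, hc⟩ := ih (p := Fin.tail p) (q := Fin.tail q) (fun i => hp i.succ)
      (fun i k => hpq i.succ k.succ) _ hrec
    refine ⟨Fin.cons b c, funext fun j => ?_⟩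
    refine Fin.cases ?_ (fun j => ?_) j
    · rw [sum_smul_syz_zero, Fin.cons_zero, hb, mul_comm]
    · rw [sum_smul_syz_succ, Fin.tail_cons, hc, Fin.cons_zero, add_sub_cancel_right]

end Staircase

lemma idealHeight_eq_two {i j : Fin (n + 1)} (hij : i ≠ j) {I : Ideal (PR K n)}
    (hle : I ≤ Ideal.span {X i, X j})
    (hprime : ∀ P : Ideal (PR K n), P.IsPrime → I ≤ P → X i ∈ P ∧ X j ∈ P) :
    idealHeight I = 2 := by
  apply le_antisymm
  · have htop : Ideal.span {X i, X j} ≠ (⊤ : Ideal (PR K n)) := by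
      intro h
      have hsub : Ideal.span {X i, X j} ≤ Ideal.span (Set.range (X : Fin (n + 1) → PR K n)) := by
        refine Ideal.span_mono ?_
        rintro _ (rfl | rfl) <;> exact ⟨_, rfl⟩
      have := mem_span_range_X.1 (hsub (h ▸ Submodule.mem_top : (1 : PR K n) ∈ _))
      simp at this
    obtain ⟨P, hP⟩ := Ideal.nonempty_minimalPrimes htop
    have hPp : P.IsPrime := hP.1.1
    refine (iInf₂_le (⟨P, hPp⟩ : PrimeSpectrum (PR K n)) (hle.trans hP.1.2)).trans ?_
    rw [← PrimeSpectrum.height_eq_orderHeight]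
    refine (Ideal.height_le_card_of_mem_minimalPrimes_span (Set.toFinite _) hP).trans ?_
    exact_mod_cast (Set.ncard_insert_le _ _).trans (by simp)
  · refine le_iInf₂ fun P hP => ?_
    obtain ⟨hi, hj⟩ := hprime P.asIdeal P.isPrime hP
    have hX : Prime (X i : PR K n) := X_prime
    let Q : PrimeSpectrum (PR K n) :=
      ⟨Ideal.span {X i}, (Ideal.span_singleton_prime hX.ne_zero).2 hX⟩
    have h1 : (⊥ : PrimeSpectrum (PR K n)) < Q := by
      rw [bot_lt_iff_ne_bot]
      intro h
      have h' : Ideal.span {(X i : PR K n)} = ⊥ := congrArg PrimeSpectrum.asIdeal h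
      exact hX.ne_zero (Ideal.span_singleton_eq_bot.1 h')
    have h2 : Q < P := by
      refine lt_of_le_of_ne ?_ ?_
      · change Ideal.span {X i} ≤ P.asIdeal
        rwa [Ideal.span_singleton_le_iff_mem]
      · rintro rfl
        have hj' : (X j : PR K n) ∈ Ideal.span {X i} := hj
        rw [Ideal.mem_span_singleton, X_dvd_X] at hj'
        exact hij hj'
    have h3 := (add_le_add_left (Order.height_add_one_le h1) 1).trans (Order.height_add_one_le h2)
    refine le_trans ?_ h3
    rw [← one_add_one_eq_two]
    exact add_le_add_left le_add_self 1

lemma hasLen1FreeRes_span {A : Type} [CommRing A] {p q : ℕ} {g : Fin p → A}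
    {z : Fin q → Fin p → A} (hli : LinearIndependent A z) (hrel : ∀ i, ∑ j, z i j * g j = 0)
    (hker : ∀ a : Fin p → A, ∑ j, a j * g j = 0 → ∃ c : Fin q → A, ∑ i, c i • z i = a) :
    HasLen1FreeRes (Ideal.span (Set.range g)) := by
  refine ⟨q, p, Fintype.linearCombination A z, Fintype.linearCombination A g,
    hli.fintypeLinearCombination_injective, ?_, Fintype.range_linearCombination _ _⟩
  ext a
  simp only [LinearMap.mem_ker, LinearMap.mem_range, Fintype.linearCombination_apply, smul_eq_mul]
  refine ⟨hker a, ?_⟩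
  rintro ⟨c, rfl⟩
  simp only [Finset.sum_apply, Pi.smul_apply, smul_eq_mul, sum_mul]
  rw [sum_comm]
  simp only [mul_assoc]
  exact sum_eq_zero fun i _ => by rw [← mul_sum, hrel, mul_zero]

lemma exists_ideal_of_lt (hn : n ≠ 0) (m : ℕ) (s : Fin (m + 1) → ℤ) (r : Fin (m + 2) → ℤ)
    (hr : Antitone r) (hsum : ∑ j, r j = ∑ i, s i) (hlt : ∀ i : Fin (m + 1), r i.castSucc < s i) :
    ∃ I : Ideal (PR K n), I ≠ ⊤ ∧ IsHomogIdeal I ∧ idealHeight I = 2 ∧ HasLen1FreeRes I ∧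
      (∀ d : ℕ, minGensDeg I d = (#{j | r j = (d : ℤ)} : ℤ)) ∧
      ∀ k : ℤ, hilbQuot I k = hPoly n k - ∑ j, hPoly n (k - r j) + ∑ i, hPoly n (k - s i) := by
  have hlt' : ∀ i : Fin (m + 1), r i.succ < s i := fun i =>
    (hr Fin.castSucc_lt_succ.le).trans_lt (hlt i)
  have h0l : (0 : Fin (n + 1)) ≠ Fin.last n := by
    simpa [Fin.ext_iff] using hn.symm
  let p : Fin (m + 1) → PR K n := fun i => X 0 ^ (s i - r i.castSucc).toNat
  let q : Fin (m + 1) → PR K n := fun i => X (Fin.last n) ^ (s i - r i.succ).toNat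
  have hp : ∀ i, p i ∈ gr K n (s i - r i.castSucc) := fun i =>
    X_pow_mem_gr _ _ (sub_pos.2 (hlt i)).le
  have hq : ∀ i, q i ∈ gr K n (s i - r i.succ) := fun i => X_pow_mem_gr _ _ (sub_pos.2 (hlt' i)).le
  have hpe : ∀ i, (s i - r i.castSucc).toNat ≠ 0 := fun i => by have := hlt i; omega
  have hqe : ∀ i, (s i - r i.succ).toNat ≠ 0 := fun i => by have := hlt' i; omega
  have hp0 : ∀ i, p i ≠ 0 := fun i => pow_ne_zero _ (X_ne_zero _)
  have hpq : ∀ i k, IsRelPrime (p i) (q k) := fun i k => by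
    refine IsRelPrime.pow ((X_prime.irreducible.isRelPrime_iff_not_dvd).2 ?_)
    rwa [X_dvd_X]
  have hg : ∀ j, stair p q j ∈ gr K n (r j) := by
    intro j
    have hdeg : r j = ∑ i, (s i - r (j.succAbove i)) := by
      rw [sum_sub_distrib, ← hsum, Fin.sum_univ_succAbove r j, add_sub_cancel_right]
    rw [hdeg]
    refine prod_mem_gr _ _ _ fun i _ => ?_
    split_ifs with h
    · rw [Fin.succAbove_of_castSucc_lt _ _ h]
      exact hp i
    · rw [Fin.succAbove_of_le_castSucc _ _ (not_lt.1 h)]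
      exact hq i
  have hz : ∀ i j, syz p q i j ∈ gr K n (s i - r j) := by
    intro i j
    refine sub_mem ?_ ?_ <;> rw [Pi.single_apply] <;> split_ifs with h
    · exact h ▸ hp i
    · exact zero_mem _
    · exact h ▸ hq i
    · exact zero_mem _
  have hli := linearIndependent_syz q hp0
  have hrel := sum_syz_mul_stair p q
  have hker := exists_sum_smul_syz hp0 hpq
  have hmin : IsMinimalFamily K n (stair p q) := by
    intro a ha j
    obtain ⟨c, rfl⟩ := hker a ha
    rw [Finset.sum_apply, map_sum]
    refine sum_eq_zero fun i _ => ?_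
    have : constantCoeff (syz p q i j) = 0 := by
      simp only [syz, Pi.sub_apply, Pi.single_apply, p, q]
      split_ifs <;> simp [hpe, hqe]
    rw [Pi.smul_apply, smul_eq_mul, map_mul, this, mul_zero]
  have hle : Ideal.span (Set.range (stair p q)) ≤ Ideal.span {X 0, X (Fin.last n)} := by
    rw [Ideal.span_le]
    rintro _ ⟨j, rfl⟩
    refine Ideal.mem_of_dvd _ (dvd_prod_of_mem _ (mem_univ 0)) ?_
    split_ifs
    · exact Ideal.pow_mem_of_mem _ (Ideal.subset_span (by simp)) _ (Nat.pos_of_ne_zero (hpe 0))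
    · exact Ideal.pow_mem_of_mem _ (Ideal.subset_span (by simp)) _ (Nat.pos_of_ne_zero (hqe 0))
  have hht : idealHeight (Ideal.span (Set.range (stair p q))) = 2 := by
    refine idealHeight_eq_two h0l hle fun P hP hPI => ⟨?_, ?_⟩
    · have := hPI (Ideal.subset_span ⟨Fin.last _, rfl⟩)
      rw [stair_last, hP.prod_mem_iff] at this
      obtain ⟨i, -, hi⟩ := this
      exact hP.mem_of_pow_mem _ hi
    · have := hPI (Ideal.subset_span ⟨0, rfl⟩)
      rw [stair_zero, hP.prod_mem_iff] at this
      obtain ⟨i, -, hi⟩ := this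
      exact hP.mem_of_pow_mem _ hi
  refine ⟨_, ?_, isHomogIdeal_span hg, hht, hasLen1FreeRes_span hli hrel hker,
    minGensDeg_span hg hmin, hilbQuot_span hg hz hli hrel hker⟩
  intro htop
  rw [htop] at hht
  have : idealHeight (⊤ : Ideal (PR K n)) = ⊤ :=
    iInf₂_eq_top.2 fun P hP => absurd (top_le_iff.1 hP) P.isPrime.ne_top
  rw [this] at hht
  exact absurd hht (by simp)

end GradedSyzygy

theorem stmt10 {K : Type} [Field K] [Infinite K] {n : ℕ} (hn : 2 ≤ n)
    (m : ℕ) (s : Fin (m + 1) → ℤ) (r : Fin (m + 2) → ℤ)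
    (hs : Antitone s) (hr : Antitone r)
    (hspos : ∀ i, 0 < s i) (hrpos : ∀ j, 0 < r j)
    (hsum : ∑ j, r j = ∑ i, s i) :
    (∀ i : Fin (m + 1), r i.castSucc < s i) ↔
      ∃ I : Ideal (PR K n), I ≠ ⊤ ∧ IsHomogIdeal I ∧ idealHeight I = 2 ∧ HasLen1FreeRes I ∧
        (∀ d : ℕ, minGensDeg I d = ((Finset.univ.filter fun j => r j = (d : ℤ)).card : ℤ)) ∧
        ∀ k : ℤ, hilbQuot I k
          = hPoly n k - ∑ j, hPoly n (k - r j) + ∑ i, hPoly n (k - s i) := by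
  constructor
  · exact GradedSyzygy.exists_ideal_of_lt (by omega) m s r hr hsum
  · rintro ⟨I, -, hI, -, hres, hgens, hhilb⟩
    exact GradedSyzygy.lt_of_exists_ideal m s r hs hr hrpos hI hres hgens hhilb
end
end

section
/- Let I ⊆ R be a proper homogeneous ideal of height at least 2. Then there exist an integer m ≥ 0 and a chain of homogeneous ideals I = J_0, J_1, …, J_m such that for each k the ideal J_{k+1} is a basic double link of J_k (of some type (d_k, a_k)), and the final ideal J_m is numerically ACM. -/
open MvPolynomial

noncomputable section

section links

variable {K : Type} [Field K] {n : ℕ}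

theorem idealHeight_eq_height {A : Type} [CommRing A] (I : Ideal A) :
    idealHeight I = I.height := by
  apply le_antisymm
  · rw [Ideal.height_eq_inf_minimalPrimes]
    refine le_iInf₂ fun P hP => ?_
    have := hP.1.1
    refine (iInf₂_le (⟨P, hP.1.1⟩ : PrimeSpectrum A) hP.1.2).trans ?_
    rw [← PrimeSpectrum.height_eq_orderHeight]
  · refine le_iInf₂ fun P hP => ?_
    rw [← PrimeSpectrum.height_eq_orderHeight]
    exact Ideal.height_mono hP

/-- The degree-`t` part of an ideal. -/
def idealPart (I : Ideal (PR K n)) (t : ℕ) : Submodule K (PR K n) :=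
  Submodule.restrictScalars K I ⊓ homogeneousSubmodule (Fin (n + 1)) K t

/-- The Hilbert series of an ideal. -/
def idealSeries (I : Ideal (PR K n)) : PowerSeries ℤ :=
  PowerSeries.mk fun t => (Module.finrank K (idealPart I t) : ℤ)

theorem mem_idealPart {I : Ideal (PR K n)} {t : ℕ} {x : PR K n} :
    x ∈ idealPart I t ↔ x ∈ I ∧ x.IsHomogeneous t := Iff.rfl

instance finiteDimensional_homogeneousSubmodule (t : ℕ) :
    FiniteDimensional K (homogeneousSubmodule (Fin (n + 1)) K t) :=
  Module.Finite.iff_fg.mpr (homogeneousSubmodule_fg (Fin (n + 1)) K t)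

instance finiteDimensional_idealPart (I : Ideal (PR K n)) (t : ℕ) :
    FiniteDimensional K (idealPart I t) :=
  Submodule.finiteDimensional_of_le inf_le_right

section graded

attribute [local instance] MvPolynomial.gradedAlgebra

theorem coe_decompose_eq_homogeneousComponent (y : PR K n) (s : ℕ) :
    (DirectSum.decompose (homogeneousSubmodule (Fin (n + 1)) K) y s : PR K n) =
      homogeneousComponent s y :=
  decomposition.decompose'_apply y s

theorem homogeneousComponent_mul_of_isHomogeneous {g : PR K n} {e : ℕ} (hg : g.IsHomogeneous e)
    (s : ℕ) (y : PR K n) :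
    homogeneousComponent (s + e) (g * y) = g * homogeneousComponent s y := by
  have := DirectSum.coe_decompose_mul_add_of_left_mem (homogeneousSubmodule (Fin (n + 1)) K)
    (i := e) (j := s) (b := y) (a := g) hg
  rwa [coe_decompose_eq_homogeneousComponent, coe_decompose_eq_homogeneousComponent,
    add_comm e s] at this

theorem homogeneousComponent_mul_of_lt {g : PR K n} {e : ℕ} (hg : g.IsHomogeneous e)
    {t : ℕ} (ht : t < e) (y : PR K n) : homogeneousComponent t (g * y) = 0 := by
  rw [← coe_decompose_eq_homogeneousComponent]
  exact DirectSum.coe_decompose_mul_of_left_mem_of_not_le (homogeneousSubmodule (Fin (n + 1)) K)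
    (b := y) (a := g) hg ht.not_ge

theorem isHomogeneous_of_isHomogIdeal {I : Ideal (PR K n)} (hI : IsHomogIdeal I) :
    I.IsHomogeneous (homogeneousSubmodule (Fin (n + 1)) K) :=
  fun d x hF => by
    rw [coe_decompose_eq_homogeneousComponent]
    exact hI x hF d

theorem isPrime_of_isHomogIdeal {I : Ideal (PR K n)} (hI : IsHomogIdeal I) (hne : I ≠ ⊤)
    (h : ∀ (g : PR K n) (e : ℕ), g.IsHomogeneous e → g ∉ I → ∀ y, g * y ∈ I → y ∈ I) :
    I.IsPrime :=
  (isHomogeneous_of_isHomogIdeal hI).isPrime_of_homogeneous_mem_or_mem hne <| by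
    rintro x y ⟨e, hx⟩ - hxy
    by_contra! hcon
    exact hcon.2 (h x e hx hcon.1 y hxy)

end graded

theorem isHomogIdeal_top : IsHomogIdeal (⊤ : Ideal (PR K n)) := fun _ _ _ => trivial

theorem IsHomogIdeal.sup {I J : Ideal (PR K n)} (hI : IsHomogIdeal I) (hJ : IsHomogIdeal J) :
    IsHomogIdeal (I ⊔ J) := by
  intro x hx d
  obtain ⟨a, ha, b, hb, rfl⟩ := Submodule.mem_sup.mp hx
  rw [map_add]
  exact Submodule.add_mem_sup (hI a ha d) (hJ b hb d)

theorem IsHomogIdeal.span_singleton_mul {I : Ideal (PR K n)} (hI : IsHomogIdeal I)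
    {g : PR K n} {e : ℕ} (hg : g.IsHomogeneous e) : IsHomogIdeal (Ideal.span {g} * I) := by
  intro x hx d
  obtain ⟨y, hy, rfl⟩ := Ideal.mem_span_singleton_mul.mp hx
  rcases lt_or_ge d e with h | h
  · rw [homogeneousComponent_mul_of_lt hg h]
    exact zero_mem _
  · obtain ⟨s, rfl⟩ := Nat.exists_eq_add_of_le' h
    rw [homogeneousComponent_mul_of_isHomogeneous hg]
    exact Ideal.mem_span_singleton_mul.mpr ⟨_, hI y hy s, rfl⟩

theorem isHomogIdeal_span_singleton {g : PR K n} {e : ℕ} (hg : g.IsHomogeneous e) :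
    IsHomogIdeal (Ideal.span {g}) := by
  simpa [← Ideal.one_eq_top] using (isHomogIdeal_top (K := K) (n := n)).span_singleton_mul hg

/-- The colon ideal `I : g`. -/
def colonElem (I : Ideal (PR K n)) (g : PR K n) : Ideal (PR K n) :=
  Submodule.comap (LinearMap.mulLeft (PR K n) g) I

theorem mem_colonElem {I : Ideal (PR K n)} {g y : PR K n} : y ∈ colonElem I g ↔ g * y ∈ I :=
  Iff.rfl

theorem le_colonElem (I : Ideal (PR K n)) (g : PR K n) : I ≤ colonElem I g :=
  fun _ hy => I.mul_mem_left g hy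

theorem IsHomogIdeal.colonElem {I : Ideal (PR K n)} (hI : IsHomogIdeal I)
    {g : PR K n} {e : ℕ} (hg : g.IsHomogeneous e) : IsHomogIdeal (colonElem I g) := by
  intro y hy s
  rw [mem_colonElem, ← homogeneousComponent_mul_of_isHomogeneous hg]
  exact hI _ hy _

theorem idealPart_span_singleton_mul (I : Ideal (PR K n)) {g : PR K n} {e : ℕ} (hg0 : g ≠ 0)
    (hg : g.IsHomogeneous e) (s : ℕ) :
    idealPart (Ideal.span {g} * I) (s + e) =
      (idealPart I s).map (LinearMap.mulLeft K g) := by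
  ext x
  simp only [mem_idealPart, Submodule.mem_map, LinearMap.mulLeft_apply,
    Ideal.mem_span_singleton_mul]
  constructor
  · rintro ⟨⟨y, hy, rfl⟩, hx⟩
    refine ⟨y, ⟨hy, ?_⟩, rfl⟩
    have h := homogeneousComponent_mul_of_isHomogeneous hg s y
    rw [homogeneousComponent_eq_self hx] at h
    rw [mul_left_cancel₀ hg0 h]
    exact homogeneousComponent_isHomogeneous s y
  · rintro ⟨y, ⟨hy, hys⟩, rfl⟩
    exact ⟨⟨y, hy, rfl⟩, add_comm s e ▸ hg.mul hys⟩

theorem idealPart_span_singleton_mul_of_lt (I : Ideal (PR K n)) {g : PR K n} {e t : ℕ}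
    (hg : g.IsHomogeneous e) (ht : t < e) : idealPart (Ideal.span {g} * I) t = ⊥ := by
  rw [eq_bot_iff]
  rintro x ⟨hx, hxt⟩
  obtain ⟨y, hy, rfl⟩ := Ideal.mem_span_singleton_mul.mp hx
  rw [SetLike.mem_coe, mem_homogeneousSubmodule] at hxt
  rw [← homogeneousComponent_eq_self hxt, homogeneousComponent_mul_of_lt hg ht]
  exact zero_mem _

theorem finrank_map_mulLeft {g : PR K n} (hg0 : g ≠ 0) (V : Submodule K (PR K n)) :
    Module.finrank K (V.map (LinearMap.mulLeft K g)) = Module.finrank K V :=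
  (LinearEquiv.finrank_eq (Submodule.equivMapOfInjective _
    (fun _ _ h => mul_left_cancel₀ hg0 h) V)).symm

theorem idealSeries_span_singleton_mul (I : Ideal (PR K n)) {g : PR K n} {e : ℕ} (hg0 : g ≠ 0)
    (hg : g.IsHomogeneous e) :
    idealSeries (Ideal.span {g} * I) = PowerSeries.X ^ e * idealSeries I := by
  ext t
  rw [PowerSeries.coeff_X_pow_mul']
  simp only [idealSeries, PowerSeries.coeff_mk]
  split_ifs with h
  · obtain ⟨s, rfl⟩ := Nat.exists_eq_add_of_le' h
    rw [idealPart_span_singleton_mul I hg0 hg, finrank_map_mulLeft hg0, Nat.add_sub_cancel]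
  · rw [idealPart_span_singleton_mul_of_lt I hg (not_le.mp h), finrank_bot, Nat.cast_zero]

theorem idealSeries_span_singleton {g : PR K n} {e : ℕ} (hg0 : g ≠ 0)
    (hg : g.IsHomogeneous e) :
    idealSeries (Ideal.span {g}) = PowerSeries.X ^ e * idealSeries (⊤ : Ideal (PR K n)) := by
  rw [← idealSeries_span_singleton_mul _ hg0 hg, Ideal.mul_top]

theorem idealPart_sup {I J : Ideal (PR K n)} (hI : IsHomogIdeal I) (hJ : IsHomogIdeal J) (t : ℕ) :
    idealPart (I ⊔ J) t = idealPart I t ⊔ idealPart J t := by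
  apply le_antisymm
  · rintro x ⟨hx, hxt⟩
    obtain ⟨a, ha, b, hb, rfl⟩ := Submodule.mem_sup.mp hx
    rw [SetLike.mem_coe, mem_homogeneousSubmodule] at hxt
    rw [← homogeneousComponent_eq_self hxt, map_add]
    exact Submodule.add_mem_sup ⟨hI a ha t, homogeneousComponent_isHomogeneous t a⟩
      ⟨hJ b hb t, homogeneousComponent_isHomogeneous t b⟩
  · refine sup_le ?_ ?_
    · exact inf_le_inf_right _ (fun x hx => Ideal.mem_sup_left hx)
    · exact inf_le_inf_right _ (fun x hx => Ideal.mem_sup_right hx)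

theorem idealSeries_sup_add_inf {I J : Ideal (PR K n)} (hI : IsHomogIdeal I)
    (hJ : IsHomogIdeal J) :
    idealSeries (I ⊔ J) + idealSeries (I ⊓ J) = idealSeries I + idealSeries J := by
  ext t
  simp only [idealSeries, map_add, PowerSeries.coeff_mk]
  have h : idealPart (I ⊓ J) t = idealPart I t ⊓ idealPart J t := by
    ext x
    simp only [mem_idealPart, Submodule.mem_inf]
    tauto
  rw [idealPart_sup hI hJ, h]
  exact_mod_cast Submodule.finrank_sup_add_finrank_inf_eq (idealPart I t) (idealPart J t)

/-- Additivity of Hilbert series along `0 → R/(I : g)(-e) → R/I → R/(I + (g)) → 0`. -/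
theorem idealSeries_sup_span_singleton {I : Ideal (PR K n)} (hI : IsHomogIdeal I) {g : PR K n}
    {e : ℕ} (hg0 : g ≠ 0) (hg : g.IsHomogeneous e) :
    idealSeries (I ⊔ Ideal.span {g}) + PowerSeries.X ^ e * idealSeries (colonElem I g) =
      idealSeries I + PowerSeries.X ^ e * idealSeries (⊤ : Ideal (PR K n)) := by
  rw [← idealSeries_span_singleton hg0 hg, ← idealSeries_sup_add_inf hI
    (isHomogIdeal_span_singleton hg), ← idealSeries_span_singleton_mul _ hg0 hg]
  congr 2
  ext x
  rw [Ideal.mem_span_singleton_mul, Submodule.mem_inf, Ideal.mem_span_singleton']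
  constructor
  · rintro ⟨y, hy, rfl⟩
    exact ⟨hy, y, mul_comm _ _⟩
  · rintro ⟨hx, y, rfl⟩
    exact ⟨y, by rwa [mem_colonElem, mul_comm], mul_comm _ _⟩

theorem finrank_idealPart_top (t : ℕ) :
    Module.finrank K (idealPart (⊤ : Ideal (PR K n)) t) = (n + t).choose n := by
  have h1 : idealPart (⊤ : Ideal (PR K n)) t =
      restrictSupport K {d : Fin (n + 1) →₀ ℕ | d.degree = t} := by
    refine Eq.trans ?_ (homogeneousSubmodule_eq_finsupp_supported (σ := Fin (n + 1)) (R := K) t)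
    ext x
    exact ⟨fun h => h.2, fun h => ⟨trivial, h⟩⟩
  have h2 : {d : Fin (n + 1) →₀ ℕ | d.degree = t} =
      ((Finset.univ : Finset (Fin (n + 1))).finsuppAntidiag t : Set (Fin (n + 1) →₀ ℕ)) := by
    ext d
    simp [Finsupp.degree_eq_sum]
  rw [h1, h2, Module.finrank_eq_nat_card_basis (basisRestrictSupport K _), Nat.card_eq_fintype_card]
  simp only [Fintype.card_coe, Finset.coe_sort_coe, Finset.card_finsuppAntidiag_nat_eq_choose,
    Finset.card_univ, Fintype.card_fin]
  rw [show n + 1 + t - 1 = n + t by lia, Nat.choose_symm_add]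

theorem idealSeries_top_mul :
    idealSeries (⊤ : Ideal (PR K n)) * (1 - PowerSeries.X) ^ (n + 1) = 1 := by
  refine Eq.trans ?_ (PowerSeries.mk_add_choose_mul_one_sub_pow_eq_one ℤ n)
  simp_rw [idealSeries, finrank_idealPart_top]

theorem mem_idealOfVars_iff (x : PR K n) :
    x ∈ idealOfVars (Fin (n + 1)) K ↔ coeff 0 x = 0 := by
  rw [← pow_one (idealOfVars _ _), mem_pow_idealOfVars_iff']
  refine ⟨fun h => h 0 (by simp), fun h d hd => ?_⟩
  rwa [(Finsupp.degree_eq_zero_iff d).mp (Nat.lt_one_iff.mp hd)]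

theorem idealOfVars_ne_top : idealOfVars (Fin (n + 1)) K ≠ ⊤ := fun h => by
  have := (mem_idealOfVars_iff (1 : PR K n)).mp (h ▸ trivial)
  simp at this

theorem coeff_zero_eq_zero_of_mem {I : Ideal (PR K n)} (hne : I ≠ ⊤) {x : PR K n}
    (h : C (coeff 0 x) ∈ I) : coeff 0 x = 0 := by
  by_contra h0
  exact hne (Ideal.eq_top_of_isUnit_mem _ h ((isUnit_iff_ne_zero.mpr h0).map C))

theorem eq_idealOfVars {I : Ideal (PR K n)} (hne : I ≠ ⊤) (hX : ∀ i, (X i : PR K n) ∈ I) :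
    I = idealOfVars (Fin (n + 1)) K := by
  have hle : idealOfVars (Fin (n + 1)) K ≤ I := Ideal.span_le.mpr (by rintro _ ⟨i, rfl⟩; exact hX i)
  refine le_antisymm (fun x hx => (mem_idealOfVars_iff x).mpr
    (coeff_zero_eq_zero_of_mem hne ?_)) hle
  have := I.sub_mem hx (hle ((mem_idealOfVars_iff (x - C (coeff 0 x))).mpr (by simp)))
  rwa [sub_sub_cancel] at this

theorem height_idealOfVars_le : (idealOfVars (Fin (n + 1)) K).height ≤ (n + 1 : ℕ) := by
  refine (Ideal.height_le_spanFinrank _ idealOfVars_ne_top).trans ?_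
  refine Nat.cast_le.mpr ((Submodule.spanFinrank_span_le_ncard_of_finite
    (Set.finite_range _)).trans ?_)
  rw [← Set.image_univ]
  refine (Set.ncard_image_le Set.finite_univ).trans ?_
  simp [Set.ncard_univ]

theorem idealPart_zero {I : Ideal (PR K n)} (hne : I ≠ ⊤) : idealPart I 0 = ⊥ := by
  rw [eq_bot_iff]
  rintro x ⟨hx, hx0⟩
  have h : homogeneousComponent 0 x = x := homogeneousComponent_eq_self hx0
  rw [homogeneousComponent_zero] at h
  rw [Submodule.mem_bot, ← h, coeff_zero_eq_zero_of_mem hne (by rwa [h]), C_0]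

theorem idealSeries_top_sub_idealOfVars :
    idealSeries (⊤ : Ideal (PR K n)) - idealSeries (idealOfVars (Fin (n + 1)) K) = 1 := by
  ext t
  rw [map_sub, idealSeries, idealSeries, PowerSeries.coeff_mk, PowerSeries.coeff_mk,
    PowerSeries.coeff_one]
  split_ifs with h
  · rw [h, finrank_idealPart_top, idealPart_zero idealOfVars_ne_top]
    simp
  · have : idealPart (⊤ : Ideal (PR K n)) t = idealPart (idealOfVars (Fin (n + 1)) K) t := by
      refine le_antisymm (fun x hx => ⟨?_, hx.2⟩) (fun x hx => ⟨trivial, hx.2⟩)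
      exact (mem_idealOfVars_iff x).mpr
        (IsHomogeneous.coeff_eq_zero (n := t) hx.2 (by simpa using Ne.symm h))
    rw [this, sub_self]

/-- The Hilbert series of the quotient by a homogeneous ideal of height at least `h`, as a multiple
of that of the polynomial ring, has a zero of order at least `h` at `1`. -/
theorem exists_hilbert_numerator (I : Ideal (PR K n)) (hI : IsHomogIdeal I) (h : ℕ)
    (hh : (h : ℕ∞) ≤ I.height) :
    ∃ q : Polynomial ℤ, idealSeries (⊤ : Ideal (PR K n)) - idealSeries I =
      (q : PowerSeries ℤ) * (1 - PowerSeries.X) ^ h * idealSeries (⊤ : Ideal (PR K n)) := by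
  induction I using WellFoundedGT.induction generalizing h with
  | ind I ih =>
  rcases eq_or_ne I ⊤ with rfl | hne
  · exact ⟨0, by simp⟩
  by_cases hdec : ∃ (g : PR K n) (e : ℕ), g.IsHomogeneous e ∧ g ∉ I ∧ ∃ y, g * y ∈ I ∧ y ∉ I
  · obtain ⟨g, e, hg, hgI, y, hgy, hy⟩ := hdec
    have hg0 : g ≠ 0 := fun h0 => hgI (h0 ▸ I.zero_mem)
    obtain ⟨q₁, hq₁⟩ := ih (I ⊔ Ideal.span {g})
      (lt_of_le_of_ne le_sup_left fun heq => hgI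
        (heq ▸ Ideal.mem_sup_right (Ideal.mem_span_singleton_self g)))
      (hI.sup (isHomogIdeal_span_singleton hg)) h (hh.trans (Ideal.height_mono le_sup_left))
    obtain ⟨q₂, hq₂⟩ := ih (colonElem I g)
      (lt_of_le_of_ne (le_colonElem I g) fun heq => hy (heq ▸ hgy))
      (hI.colonElem hg) h (hh.trans (Ideal.height_mono (le_colonElem I g)))
    refine ⟨q₁ + Polynomial.X ^ e * q₂, ?_⟩
    have := idealSeries_sup_span_singleton hI hg0 hg
    push_cast
    linear_combination hq₁ + PowerSeries.X ^ e * hq₂ + this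
  push Not at hdec
  have hprime : I.IsPrime := isPrime_of_isHomogIdeal hI hne hdec
  by_cases hX : ∀ i, (X i : PR K n) ∈ I
  · have hIX := eq_idealOfVars hne hX
    obtain ⟨k, hk⟩ := Nat.exists_eq_add_of_le
      (Nat.cast_le.mp (hh.trans (hIX ▸ height_idealOfVars_le)))
    refine ⟨(1 - Polynomial.X) ^ k, ?_⟩
    have h1 : idealSeries (⊤ : Ideal (PR K n)) * (1 - PowerSeries.X) ^ (h + k) = 1 :=
      hk ▸ idealSeries_top_mul
    rw [pow_add] at h1
    rw [hIX, idealSeries_top_sub_idealOfVars]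
    push_cast
    linear_combination -h1
  push Not at hX
  obtain ⟨i, hi⟩ := hX
  have hi1 : (X i : PR K n).IsHomogeneous 1 := isHomogeneous_X K i
  have hlt : I < I ⊔ Ideal.span {X i} := lt_of_le_of_ne le_sup_left fun heq => hi
        (heq ▸ Ideal.mem_sup_right (Ideal.mem_span_singleton_self _))
  obtain ⟨q, hq⟩ := ih (I ⊔ Ideal.span {X i}) hlt (hI.sup (isHomogIdeal_span_singleton hi1)) (h + 1)
    (by
      rw [← idealHeight_eq_height]
      refine le_iInf₂ fun P hP => ?_
      rw [← PrimeSpectrum.height_eq_orderHeight]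
      have := P.2
      push_cast
      exact (add_le_add_left hh 1).trans
        (Ideal.height_add_one_le_of_lt_of_isPrime (hlt.trans_le hP)))
  refine ⟨q, ?_⟩
  have hcolon : colonElem I (X i) = I :=
    le_antisymm (fun y hy => hdec _ 1 hi1 hi y hy) (le_colonElem I _)
  have := idealSeries_sup_span_singleton hI (X_ne_zero i) hi1
  rw [hcolon] at this
  have h1 : (1 - PowerSeries.X : PowerSeries ℤ) ≠ 0 := by
    intro h0
    have := congrArg PowerSeries.constantCoeff h0
    simp at this
  apply mul_left_cancel₀ h1
  linear_combination hq + this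

/-- `L` is a prime linear form that divides neither the degree-`D` form `F` nor `X 0`. -/
structure LinkData (F L : PR K n) (D : ℕ) : Prop where
  ne_zero : F ≠ 0
  isHomogeneous : F.IsHomogeneous D
  prime : Prime L
  isHomogeneous_one : L.IsHomogeneous 1
  not_dvd : ¬ L ∣ F
  not_dvd_X : ¬ L ∣ X 0

namespace LinkData

variable {F L : PR K n} {D : ℕ}

theorem mul_X_pow (h : LinkData F L D) (j : ℕ) : LinkData (F * X 0 ^ j) L (D + j) where
  ne_zero := mul_ne_zero h.ne_zero (pow_ne_zero _ (X_ne_zero 0))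
  isHomogeneous := h.isHomogeneous.mul (isHomogeneous_X_pow 0 j)
  prime := h.prime
  isHomogeneous_one := h.isHomogeneous_one
  not_dvd hd := (h.prime.dvd_or_dvd hd).elim h.not_dvd
    fun hd => h.not_dvd_X (h.prime.dvd_of_dvd_pow hd)
  not_dvd_X := h.not_dvd_X

theorem isRegSeq (h : LinkData F L D) : IsRegSeq F L := by
  refine ⟨fun x y hxy => mul_left_cancel₀ h.ne_zero hxy, ?_⟩
  rw [isSMulRegular_iff_right_eq_zero_of_smul]
  intro x hx
  obtain ⟨x, rfl⟩ := Ideal.Quotient.mk_surjective x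
  rw [smul_eq_mul, ← map_mul, Ideal.Quotient.eq_zero_iff_mem, Ideal.mem_span_singleton] at hx
  rw [Ideal.Quotient.eq_zero_iff_mem, Ideal.mem_span_singleton]
  obtain ⟨y, hy⟩ := hx
  obtain ⟨z, rfl⟩ := (h.prime.dvd_or_dvd (hy ▸ dvd_mul_right L x)).resolve_left h.not_dvd
  exact ⟨z, mul_left_cancel₀ h.prime.ne_zero (by rw [hy]; ring)⟩

theorem colonElem_eq (h : LinkData F L D) {I : Ideal (PR K n)} (hF : F ∈ I) :
    colonElem (Ideal.span {L} * I) F = Ideal.span {L} := by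
  ext x
  rw [mem_colonElem, Ideal.mem_span_singleton_mul, Ideal.mem_span_singleton]
  constructor
  · rintro ⟨y, -, hy⟩
    exact (h.prime.dvd_or_dvd (hy ▸ dvd_mul_right L y)).resolve_left h.not_dvd
  · rintro ⟨y, rfl⟩
    exact ⟨F * y, I.mul_mem_right y hF, by ring⟩

theorem isHomogIdeal_link (h : LinkData F L D) {I : Ideal (PR K n)} (hI : IsHomogIdeal I) :
    IsHomogIdeal (Ideal.span {L} * I + Ideal.span {F}) :=
  (hI.span_singleton_mul h.isHomogeneous_one).sup (isHomogIdeal_span_singleton h.isHomogeneous)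

theorem idealSeries_link (h : LinkData F L D) {I : Ideal (PR K n)} (hI : IsHomogIdeal I)
    (hF : F ∈ I) :
    idealSeries (Ideal.span {L} * I + Ideal.span {F}) = PowerSeries.X * idealSeries I +
      PowerSeries.X ^ D * (1 - PowerSeries.X) * idealSeries (⊤ : Ideal (PR K n)) := by
  have := idealSeries_sup_span_singleton (hI.span_singleton_mul h.isHomogeneous_one) h.ne_zero
    h.isHomogeneous
  rw [h.colonElem_eq hF, idealSeries_span_singleton_mul _ h.prime.ne_zero h.isHomogeneous_one,
    idealSeries_span_singleton h.prime.ne_zero h.isHomogeneous_one] at this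
  rw [Submodule.add_eq_sup]
  linear_combination this

/-- One basic double link of `J` by `L` and a multiple of `F` by a power of `X 0`. -/
def Step (F L : PR K n) (J J' : Ideal (PR K n)) : Prop :=
  ∃ j, F * X 0 ^ j ∈ J ∧ J' = Ideal.span {L} * J + Ideal.span {F * X 0 ^ j}

theorem isBDL_of_step (h : LinkData F L D) {J J' : Ideal (PR K n)} (hJ : Step F L J J') :
    ∃ d a, IsBDL J J' d a := by
  obtain ⟨j, hj, rfl⟩ := hJ
  have hd := h.mul_X_pow j
  exact ⟨D + j, 1, _, L, hj, hd.ne_zero, hd.isHomogeneous, le_rfl, hd.isHomogeneous_one,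
    hd.isRegSeq, rfl⟩

theorem exists_steps_block (h : LinkData F L D) (c : ℕ) {J : Ideal (PR K n)} {j : ℕ}
    (hJ : IsHomogIdeal J) (hj : F * X 0 ^ j ∈ J) :
    ∃ J', Relation.ReflTransGen (Step F L) J J' ∧ IsHomogIdeal J' ∧ F * X 0 ^ (j + c) ∈ J' ∧
      idealSeries J' = PowerSeries.X ^ (c + 1) * idealSeries J +
        ((c + 1 : ℕ) : PowerSeries ℤ) * PowerSeries.X ^ (D + j + c) * (1 - PowerSeries.X) *
          idealSeries (⊤ : Ideal (PR K n)) := by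
  induction c with
  | zero =>
    have hd := h.mul_X_pow j
    refine ⟨_, .single ⟨j, hj, rfl⟩, hd.isHomogIdeal_link hJ,
      Ideal.mem_sup_right (Ideal.mem_span_singleton_self _), ?_⟩
    rw [hd.idealSeries_link hJ hj]
    push_cast
    ring
  | succ c ih =>
    obtain ⟨J', hJJ', hJ', hF, hs⟩ := ih
    have hd := h.mul_X_pow (j + (c + 1))
    have hF' : F * X 0 ^ (j + (c + 1)) ∈ J' := by
      rw [← add_assoc, pow_succ, ← mul_assoc]
      exact J'.mul_mem_right _ hF
    refine ⟨_, hJJ'.tail ⟨_, hF', rfl⟩, hd.isHomogIdeal_link hJ',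
      Ideal.mem_sup_right (Ideal.mem_span_singleton_self _), ?_⟩
    rw [hd.idealSeries_link hJ' hF', hs]
    push_cast
    ring

theorem exists_steps (h : LinkData F L D) (c : ℕ → ℕ) (N : ℕ) {J : Ideal (PR K n)} {j e : ℕ}
    (hJ : IsHomogIdeal J) (hj : F * X 0 ^ j ∈ J) (he : D + j = e + N) :
    ∃ J', Relation.ReflTransGen (Step F L) J J' ∧ IsHomogIdeal J' ∧
      idealSeries J' = PowerSeries.X ^ (∑ i ∈ Finset.range N, (c i + 1)) *
        (idealSeries J + PowerSeries.X ^ e * (1 - PowerSeries.X) *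
          (∑ i ∈ Finset.range N, ((c i + 1 : ℕ) : PowerSeries ℤ) * PowerSeries.X ^ i) *
            idealSeries (⊤ : Ideal (PR K n))) := by
  induction N generalizing J j e with
  | zero => exact ⟨J, .refl, hJ, by simp⟩
  | succ N ih =>
    obtain ⟨J₁, hJJ₁, hJ₁, hF₁, hs₁⟩ := h.exists_steps_block (c N) hJ hj
    obtain ⟨J₂, hJJ₂, hJ₂, hs₂⟩ := ih (e := e + (c N + 1)) hJ₁ hF₁ (by lia)
    refine ⟨J₂, hJJ₁.trans hJJ₂, hJ₂, ?_⟩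
    rw [hs₂, hs₁, Finset.sum_range_succ, Finset.sum_range_succ, he]
    push_cast
    ring

end LinkData

theorem exists_sequence_of_reflTransGen {α : Type*} {r : α → α → Prop} {a b : α}
    (h : Relation.ReflTransGen r a b) :
    ∃ (m : ℕ) (f : ℕ → α), f 0 = a ∧ (∀ k < m, r (f k) (f (k + 1))) ∧ f m = b := by
  induction h using Relation.ReflTransGen.head_induction_on with
  | refl => exact ⟨0, fun _ => b, rfl, by simp, rfl⟩
  | @head a c hac _ ih =>
    obtain ⟨m, f, hf0, hf, hfm⟩ := ih
    refine ⟨m + 1, fun k => Nat.casesOn k a f, rfl, ?_, hfm⟩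
    rintro (_ | k) hk
    · change r a (f 0)
      rwa [hf0]
    · exact hf k (by lia)

theorem hasLen1FreeRes_top {A : Type} [CommRing A] : HasLen1FreeRes (⊤ : Ideal A) := by
  refine ⟨0, 1, 0, LinearMap.proj 0, Function.injective_of_subsingleton _, ?_, ?_⟩
  · ext x
    simp only [LinearMap.mem_ker, LinearMap.proj_apply, LinearMap.range_zero, Submodule.mem_bot]
    exact ⟨fun h => funext fun i => by rw [Subsingleton.elim i 0, h]; rfl, fun h => by simp [h]⟩
  · exact LinearMap.range_eq_top.mpr (LinearMap.proj_surjective 0)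

theorem HasLen1FreeRes.link {A : Type} [CommRing A] [IsDomain A] {J : Ideal A}
    (hJ : HasLen1FreeRes J) {F L : A} (hF : F ∈ J) (hL : Prime L) (hLF : ¬ L ∣ F) :
    HasLen1FreeRes (Ideal.span {L} * J + Ideal.span {F}) := by
  obtain ⟨p, q, f, g, hf, hfg, hg⟩ := hJ
  obtain ⟨w, hw⟩ : F ∈ LinearMap.range g := hg ▸ hF
  let ep := Fin.consLinearEquiv A (fun _ : Fin (p + 1) => A)
  let eq := Fin.consLinearEquiv A (fun _ : Fin (q + 1) => A)
  let f' : A × (Fin p → A) →ₗ[A] A × (Fin q → A) :=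
    (-(L • LinearMap.fst A A (Fin p → A))).prod
      ((LinearMap.fst A A (Fin p → A)).smulRight w + f ∘ₗ LinearMap.snd A A (Fin p → A))
  let g' : A × (Fin q → A) →ₗ[A] A :=
    (LinearMap.fst A A (Fin q → A)).smulRight F + L • (g ∘ₗ LinearMap.snd A A (Fin q → A))
  have hf'_apply : ∀ x, f' x = (-(L * x.1), x.1 • w + f x.2) := fun x => rfl
  have hg'_apply : ∀ x, g' x = x.1 * F + L * g x.2 := fun x => rfl
  have hf' : Function.Injective f' := by
    rw [injective_iff_map_eq_zero]
    rintro ⟨a, u⟩ h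
    rw [hf'_apply, Prod.mk_eq_zero, neg_eq_zero] at h
    have ha : a = 0 := (mul_eq_zero.mp h.1).resolve_left hL.ne_zero
    subst ha
    simp only [zero_smul, zero_add, true_and, mul_zero] at h
    rw [(injective_iff_map_eq_zero f).mp hf u h]
    rfl
  have hfg' : ∀ x, g' x = 0 ↔ ∃ y, f' y = x := by
    rintro ⟨a, v⟩
    simp only [hg'_apply, hf'_apply, Prod.exists, Prod.mk.injEq]
    constructor
    · intro h
      obtain ⟨b, rfl⟩ := (hL.dvd_or_dvd (⟨-g v, by linear_combination h⟩ : L ∣ a * F)).resolve_right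
        hLF
      have hv : v + b • w ∈ LinearMap.ker g := by
        rw [LinearMap.mem_ker, map_add, map_smul, hw, smul_eq_mul]
        exact (mul_eq_zero.mp (show L * (g v + b * F) = 0 by linear_combination h)).resolve_left
          hL.ne_zero
      rw [hfg] at hv
      obtain ⟨u, hu⟩ := hv
      exact ⟨-b, u, by ring, by rw [hu]; module⟩
    · rintro ⟨b, u, rfl, rfl⟩
      have hu : g (f u) = 0 := LinearMap.mem_ker.mp (hfg ▸ LinearMap.mem_range_self f u)
      rw [map_add, map_smul, hw, hu, smul_eq_mul]
      ring
  refine ⟨p + 1, q + 1, eq.toLinearMap ∘ₗ f' ∘ₗ ep.symm.toLinearMap,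
    g' ∘ₗ eq.symm.toLinearMap, ?_, ?_, ?_⟩
  · exact eq.injective.comp (hf'.comp ep.symm.injective)
  · ext x
    rw [LinearMap.mem_ker, LinearMap.mem_range]
    refine (hfg' (eq.symm x)).trans ⟨?_, ?_⟩
    · rintro ⟨y, hy⟩
      refine ⟨ep y, ?_⟩
      simp [hy]
    · rintro ⟨y, rfl⟩
      exact ⟨ep.symm y, by simp⟩
  · ext x
    rw [LinearMap.mem_range, Submodule.add_eq_sup, Submodule.mem_sup]
    constructor
    · rintro ⟨y, rfl⟩
      refine ⟨L * g (eq.symm y).2, Ideal.mem_span_singleton_mul.mpr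
        ⟨_, hg ▸ LinearMap.mem_range_self g _, rfl⟩, (eq.symm y).1 * F,
        Ideal.mul_mem_left _ _ (Ideal.mem_span_singleton_self F), ?_⟩
      rw [add_comm]
      rfl
    · rintro ⟨a, ha, b, hb, rfl⟩
      obtain ⟨y, hy, rfl⟩ := Ideal.mem_span_singleton_mul.mp ha
      obtain ⟨z, rfl⟩ := Ideal.mem_span_singleton'.mp hb
      rw [← hg] at hy
      obtain ⟨v, rfl⟩ := hy
      refine ⟨eq (z, v), ?_⟩
      simp [hg'_apply, add_comm]

theorem exists_linkData [Infinite K] {i : Fin (n + 1)} (hi : i ≠ 0) {F : PR K n} {D : ℕ}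
    (hF : F ≠ 0) (hFD : F.IsHomogeneous D) : ∃ L, LinkData F L D := by
  obtain ⟨a, ha⟩ : ∃ a, eval a (F * X 0) ≠ 0 := by
    by_contra! h
    exact mul_ne_zero hF (X_ne_zero 0) (MvPolynomial.funext fun a => by rw [h, map_zero])
  rw [map_mul, eval_X] at ha
  have hFa := left_ne_zero_of_mul ha
  have ha0 := right_ne_zero_of_mul ha
  let L : PR K n := X i - C (a i / a 0) * X 0
  have hLa : eval a L = 0 := by simp [L, ha0]
  have hL1 : L.IsHomogeneous 1 := (isHomogeneous_X K i).sub ((isHomogeneous_X K 0).C_mul _)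
  have hcoeff : coeff (Finsupp.single i 1) L = 1 := by
    simp [L, coeff_X, coeff_C_mul, hi.symm, Finsupp.single_left_inj]
  have hL0 : L ≠ 0 := by
    intro h0
    simp [h0] at hcoeff
  have hirr : Irreducible L := irreducible_of_totalDegree_eq_one (hL1.totalDegree hL0)
    fun x hx => isUnit_of_dvd_one (hcoeff ▸ hx _)
  refine ⟨L, hF, hFD, hirr.prime, hL1, ?_, ?_⟩
  · rintro ⟨y, rfl⟩
    simp [hLa] at hFa
  · rintro ⟨y, hy⟩
    have := congrArg (eval a) hy
    rw [map_mul, hLa, zero_mul, eval_X] at this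
    exact ha0 this

theorem linkData_X {i : Fin (n + 1)} (hi : i ≠ 0) : LinkData (X 0 : PR K n) (X i) 1 where
  ne_zero := X_ne_zero 0
  isHomogeneous := isHomogeneous_X K 0
  prime := X_prime
  isHomogeneous_one := isHomogeneous_X K i
  not_dvd h := hi (X_dvd_X.mp h)
  not_dvd_X h := hi (X_dvd_X.mp h)

theorem exists_ne_zero_isHomogeneous_mem {I : Ideal (PR K n)} (hI : IsHomogIdeal I)
    (h : I ≠ ⊥) : ∃ (F : PR K n) (d : ℕ), F ∈ I ∧ F ≠ 0 ∧ F.IsHomogeneous d := by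
  obtain ⟨F, hF, hF0⟩ := Submodule.exists_mem_ne_zero_of_ne_bot h
  by_contra! hall
  refine hF0 ?_
  rw [← sum_homogeneousComponent F]
  refine Finset.sum_eq_zero fun d _ => ?_
  by_contra hd
  exact hall _ d (hI F hF d) hd (homogeneousComponent_isHomogeneous d F)

theorem constantCoeff_idealSeries (I : Ideal (PR K n)) :
    PowerSeries.constantCoeff (idealSeries I) = Module.finrank K (idealPart I 0) := by
  rw [← PowerSeries.coeff_zero_eq_constantCoeff_apply, idealSeries, PowerSeries.coeff_mk]

theorem constantCoeff_idealSeries_top :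
    PowerSeries.constantCoeff (idealSeries (⊤ : Ideal (PR K n))) = 1 := by
  simpa using congrArg PowerSeries.constantCoeff (idealSeries_top_mul (K := K) (n := n))

theorem constantCoeff_idealSeries_of_ne_top {I : Ideal (PR K n)} (h : I ≠ ⊤) :
    PowerSeries.constantCoeff (idealSeries I) = 0 := by
  rw [constantCoeff_idealSeries, idealPart_zero h, finrank_bot, Nat.cast_zero]

theorem hilbQuot_eq_of_idealSeries_eq {I J : Ideal (PR K n)} (h : idealSeries I = idealSeries J)
    (t : ℤ) : hilbQuot I t = hilbQuot J t := by
  have := congrArg (PowerSeries.coeff t.toNat) h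
  rw [idealSeries, idealSeries, PowerSeries.coeff_mk, PowerSeries.coeff_mk] at this
  unfold idealPart at this
  unfold hilbQuot
  rw [this]

/-- The properties of the ideals obtained from the unit ideal by basic double links with forms
`X 0 ^ k` and the linear form `X i`. -/
structure IsStairIdeal (i : Fin (n + 1)) (J : Ideal (PR K n)) : Prop where
  hasLen1FreeRes : HasLen1FreeRes J
  eq_top_or_le : J = ⊤ ∨ J ≤ Ideal.span {X 0, X i}
  X_zero_pow_mem : ∃ k, X 0 ^ k ∈ J
  X_pow_mem : ∃ k, X i ^ k ∈ J

namespace IsStairIdeal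

variable {i : Fin (n + 1)} {J : Ideal (PR K n)}

theorem of_reflTransGen (hi : i ≠ 0)
    (h : Relation.ReflTransGen (LinkData.Step (X 0) (X i)) ⊤ J) : IsStairIdeal i J := by
  induction h with
  | refl => exact ⟨hasLen1FreeRes_top, .inl rfl, ⟨0, trivial⟩, ⟨0, trivial⟩⟩
  | tail _ hJJ' ih =>
    obtain ⟨j, hj, rfl⟩ := hJJ'
    have hd := (linkData_X (K := K) hi).mul_X_pow j
    obtain ⟨k, hk⟩ := ih.X_pow_mem
    refine ⟨ih.hasLen1FreeRes.link hj hd.prime hd.not_dvd, .inr (sup_le ?_ ?_), ⟨j + 1, ?_⟩,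
      ⟨k + 1, ?_⟩⟩
    · exact Ideal.mul_le_left.trans (Ideal.span_mono (by simp))
    · rw [Ideal.span_singleton_le_iff_mem]
      exact Ideal.mul_mem_right _ _ (Ideal.subset_span (by simp))
    · rw [pow_succ']
      exact Ideal.mem_sup_right (Ideal.mem_span_singleton_self _)
    · rw [pow_succ']
      exact Ideal.mem_sup_left (Ideal.mul_mem_mul (Ideal.mem_span_singleton_self _) hk)

theorem idealHeight_eq_two (hJ : IsStairIdeal i J) (hi : i ≠ 0) (hne : J ≠ ⊤) :
    idealHeight J = 2 := by
  apply le_antisymm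
  · rw [idealHeight_eq_height]
    refine (Ideal.height_mono (hJ.eq_top_or_le.resolve_left hne)).trans
      ((Ideal.height_le_spanFinrank _ ?_).trans ?_)
    · intro htop
      have h1 : (1 : PR K n) ∈ Ideal.span {X 0, X i} := htop ▸ trivial
      obtain ⟨a, b, hab⟩ := Ideal.mem_span_pair.mp h1
      simpa using congrArg constantCoeff hab
    · exact_mod_cast (Submodule.spanFinrank_span_le_ncard_of_finite (Set.toFinite _)).trans
        ((Set.ncard_insert_le _ _).trans (by simp))
  · refine le_iInf₂ fun P hP => ?_
    have hP0 : X 0 ∈ P.asIdeal :=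
      hJ.X_zero_pow_mem.elim fun k hk => P.2.mem_of_pow_mem k (hP hk)
    have hPi : X i ∈ P.asIdeal := hJ.X_pow_mem.elim fun k hk => P.2.mem_of_pow_mem k (hP hk)
    let Q : PrimeSpectrum (PR K n) := ⟨Ideal.span {X 0},
      (Ideal.span_singleton_prime (X_ne_zero 0)).mpr X_prime⟩
    have hQ : ⊥ < Q := by
      refine lt_of_le_of_ne bot_le fun h => X_ne_zero (R := K) (0 : Fin (n + 1)) ?_
      have h0 : X 0 ∈ Q.asIdeal := Ideal.mem_span_singleton_self _
      rwa [← h] at h0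
    have hQP : Q < P := by
      refine lt_of_le_of_ne ((Ideal.span_singleton_le_iff_mem _).mpr hP0) fun h => hi.symm ?_
      rw [← h] at hPi
      exact X_dvd_X.mp (Ideal.mem_span_singleton.mp hPi)
    calc (2 : ℕ∞) ≤ Order.height (⊥ : PrimeSpectrum (PR K n)) + 1 + 1 := by
          rw [add_assoc, one_add_one_eq_two]
          exact le_add_self
      _ ≤ Order.height Q + 1 := by gcongr; exact Order.height_add_one_le hQ
      _ ≤ Order.height P := Order.height_add_one_le hQP

end IsStairIdeal

/-- The numbers of basic double links that transform the Hilbert series with numerator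
`1 - p * (1 - X) ^ 2` and the one of the unit ideal into each other. -/
theorem exists_link_numbers (p : Polynomial ℤ) (hp : p.coeff 0 = 1) (M : ℕ) :
    ∃ (N C : ℕ) (c : ℕ → ℕ), M ≤ N ∧ 1 ≤ N ∧
      ∑ i ∈ Finset.range N, (c i + 1) = (∑ _i ∈ Finset.range N, (C + 1)) + 1 ∧
      1 - (p : PowerSeries ℤ) * (1 - PowerSeries.X) ^ 2 + PowerSeries.X * (1 - PowerSeries.X) *
          ∑ i ∈ Finset.range N, ((C + 1 : ℕ) : PowerSeries ℤ) * PowerSeries.X ^ i =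
        PowerSeries.X * (1 + (1 - PowerSeries.X) *
          ∑ i ∈ Finset.range N, ((c i + 1 : ℕ) : PowerSeries ℤ) * PowerSeries.X ^ i) := by
  let N := M + p.natDegree + 1
  let C := ∑ i ∈ Finset.range N, (p.coeff (i + 1) - p.coeff i).natAbs
  let c : ℕ → ℕ := fun i => (C + p.coeff i - p.coeff (i + 1)).toNat
  have hc : ∀ i ∈ Finset.range N, (c i : ℤ) = C + p.coeff i - p.coeff (i + 1) := by
    intro i hi
    have : (p.coeff (i + 1) - p.coeff i).natAbs ≤ C :=
      Finset.single_le_sum (f := fun i => (p.coeff (i + 1) - p.coeff i).natAbs)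
        (fun _ _ => Nat.zero_le _) hi
    exact Int.toNat_of_nonneg (by lia)
  have hpN : p.coeff N = 0 := Polynomial.coeff_eq_zero_of_natDegree_lt (by lia)
  refine ⟨N, C, c, by lia, by lia, ?_, ?_⟩
  · have := Finset.sum_range_sub' p.coeff N
    zify
    rw [Finset.sum_congr rfl fun i hi => show (c i : ℤ) + 1 =
      (C + 1) + (p.coeff i - p.coeff (i + 1)) by rw [hc i hi]; ring, Finset.sum_add_distrib, this,
      hp, hpN, sub_zero]
  · have hsum : (p : PowerSeries ℤ) =
        ∑ i ∈ Finset.range N, (p.coeff i : PowerSeries ℤ) * PowerSeries.X ^ i := by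
      conv_lhs => rw [p.as_sum_range' N (by lia)]
      rw [← Polynomial.coeToPowerSeries.ringHom_apply, map_sum]
      refine Finset.sum_congr rfl fun i _ => ?_
      rw [← Polynomial.C_mul_X_pow_eq_monomial, map_mul, map_pow, eq_intCast, map_intCast,
        Polynomial.coeToPowerSeries.ringHom_apply, Polynomial.coe_X]
    have hsum' : (p : PowerSeries ℤ) = 1 + PowerSeries.X *
        ∑ i ∈ Finset.range N, (p.coeff (i + 1) : PowerSeries ℤ) * PowerSeries.X ^ i := by
      have := Finset.sum_range_succ' (fun i => (p.coeff i : PowerSeries ℤ) * PowerSeries.X ^ i) N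
      rw [Finset.sum_range_succ, ← hsum, hpN, hp, Int.cast_zero, zero_mul, add_zero, pow_zero,
        Int.cast_one, mul_one] at this
      rw [this, add_comm, Finset.mul_sum]
      congr 1
      exact Finset.sum_congr rfl fun i _ => by ring
    have hcsum : ∑ i ∈ Finset.range N, ((c i + 1 : ℕ) : PowerSeries ℤ) * PowerSeries.X ^ i =
        ∑ i ∈ Finset.range N, ((C + 1 : ℕ) : PowerSeries ℤ) * PowerSeries.X ^ i +
        (∑ i ∈ Finset.range N, (p.coeff i : PowerSeries ℤ) * PowerSeries.X ^ i -
        ∑ i ∈ Finset.range N, (p.coeff (i + 1) : PowerSeries ℤ) * PowerSeries.X ^ i) := by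
      rw [← Finset.sum_sub_distrib, ← Finset.sum_add_distrib]
      refine Finset.sum_congr rfl fun i hi => ?_
      have : ((c i : ℤ) : PowerSeries ℤ) = _ := congrArg _ (hc i hi)
      push_cast at this ⊢
      rw [this]
      ring
    rw [hcsum, ← hsum]
    linear_combination -(1 - PowerSeries.X : PowerSeries ℤ) * hsum'

end links

theorem stmt12 {K : Type} [Field K] [Infinite K] {n : ℕ} (hn : 2 ≤ n)
    (I : Ideal (PR K n)) (hI : IsHomogIdeal I) (hIp : I ≠ ⊤) (hht : 2 ≤ idealHeight I) :
    ∃ (m : ℕ) (Js : ℕ → Ideal (PR K n)), Js 0 = I ∧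
      (∀ k < m, ∃ d a : ℕ, IsBDL (Js k) (Js (k + 1)) d a) ∧
      NumACM (Js m) := by
  have hi : Fin.last n ≠ 0 := Fin.ne_of_gt (Fin.lt_def.mpr (by simp; lia))
  rw [idealHeight_eq_height] at hht
  have hbot : I ≠ ⊥ := by
    rintro rfl
    simp at hht
  obtain ⟨F, d, hFI, hF0, hFd⟩ := exists_ne_zero_isHomogeneous_mem hI hbot
  obtain ⟨L, hL⟩ := exists_linkData hi hF0 hFd
  obtain ⟨p, hp⟩ := exists_hilbert_numerator I hI 2 hht
  have hp0 : p.coeff 0 = 1 := by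
    have := congrArg PowerSeries.constantCoeff hp
    simpa [constantCoeff_idealSeries_top, constantCoeff_idealSeries_of_ne_top hIp] using this.symm
  obtain ⟨N, C, c, hdN, hN, hsum, hseries⟩ := exists_link_numbers p hp0 d
  obtain ⟨J, hIJ, -, hJs⟩ := hL.exists_steps (fun _ => C) N (j := N + 1 - d) (e := 1) hI
    (I.mul_mem_right _ hFI) (by lia)
  obtain ⟨J', hJ', hJ'hom, hJ's⟩ := (linkData_X (K := K) hi).exists_steps c N (j := N - 1) (e := 0)
    isHomogIdeal_top trivial (by lia)
  have hstair := IsStairIdeal.of_reflTransGen hi hJ'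
  have hJ'ne : J' ≠ ⊤ := by
    rintro rfl
    have := congrArg PowerSeries.constantCoeff hJ's
    simp [constantCoeff_idealSeries_top, hsum] at this
  have hJJ' : idealSeries J' = idealSeries J := by
    rw [hJs, hJ's, hsum, pow_succ]
    linear_combination PowerSeries.X ^ (∑ _i ∈ Finset.range N, (C + 1)) *
      (hp - idealSeries (⊤ : Ideal (PR K n)) * hseries)
  obtain ⟨m, Js, hJs0, hstep, hJsm⟩ := exists_sequence_of_reflTransGen hIJ
  refine ⟨m, Js, hJs0, fun k hk => hL.isBDL_of_step (hstep k hk), J', hJ'ne, hJ'hom,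
    hstair.idealHeight_eq_two hi hJ'ne, hstair.hasLen1FreeRes, fun t => ?_⟩
  rw [hJsm]
  exact hilbQuot_eq_of_idealSeries_eq hJJ' t
end
end
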